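/- arXiv:math/0509339 — 6 statements merged into one kernel-verified Lean document; each statement's English description precedes it below -/
import Mathlib

section
/- Let g_0(n) denote the maximum number g such that there exists a Class 0 graph G on at most n vertices containing a cycle and with girth(G) ≥ g. Then for all n ≥ 3, ⌊√((lg n)/2 + 1/4) − 1/2⌋ ≤ g_0(n) ≤ 1 + 2·lg n, where lg denotes the base-2 logarithm. -/
open SimpleGraph Finset

variable {V : Type*}

open Classical in
/-- A single pebbling step: remove two pebbles from `u` and add one pebble on a
neighbor `v` of `u`. -/
noncomputable def PebStep (G : SimpleGraph V) (C C' : V → ℕ) : Prop :=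
  ∃ u v : V, G.Adj u v ∧ 2 ≤ C u ∧
    C' = Function.update (Function.update C u (C u - 2)) v (C v + 1)

/-- The configuration `C` reaches the root `r` if some finite sequence of pebbling
steps starting from `C` produces a configuration with a pebble on `r`. -/
def Reaches (G : SimpleGraph V) (C : V → ℕ) (r : V) : Prop :=
  ∃ C', Relation.ReflTransGen (PebStep G) C C' ∧ 1 ≤ C' r

/-- The pebbling number of `G`: the least `m` such that every configuration of size `m`
reaches every root vertex. -/
noncomputable def pebblingNumber (G : SimpleGraph V) [Fintype V] : ℕ :=
  sInf {m : ℕ | ∀ (r : V) (C : V → ℕ), ∑ v, C v = m → Reaches G C r}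

/-- `girthClass0 n`: the largest `g` such that some Class 0 graph on at most `n`
vertices contains a cycle and has girth at least `g`. -/
noncomputable def girthClass0 (n : ℕ) : ℕ :=
  sSup {g : ℕ | ∃ m ≤ n, ∃ G : SimpleGraph (Fin m), G.Connected ∧
    pebblingNumber G = Fintype.card (Fin m) ∧ ¬ G.IsAcyclic ∧ g ≤ G.girth}

section Pebbling

open scoped Classical

variable {G : SimpleGraph V}

theorem pebStep_add_single {u v : V} (h : G.Adj u v) (E : V → ℕ) :
    PebStep G (E + Pi.single u 2) (E + Pi.single v 1) := by
  refine ⟨u, v, h, by simp, ?_⟩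
  have := h.ne
  ext w
  by_cases hw : w = v
  · subst hw; simp [this.symm]
  · by_cases hu : w = u
    · subst hu; simp [this]
    · simp [hw, hu]

theorem PebStep.exists_eq_add {C C' : V → ℕ} (h : PebStep G C C') :
    ∃ (u v : V) (E : V → ℕ), G.Adj u v ∧ C = E + Pi.single u 2 ∧ C' = E + Pi.single v 1 := by
  obtain ⟨u, v, h, h2, rfl⟩ := h
  have := h.ne
  refine ⟨u, v, Function.update C u (C u - 2), h, ?_, ?_⟩
  · ext w
    by_cases hu : w = u
    · subst hu; simp; omega
    · simp [hu]
  · ext w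
    by_cases hw : w = v
    · subst hw; simp [this.symm]
    · simp [Function.update_apply, hw]

theorem PebStep.add {C C' : V → ℕ} (h : PebStep G C C') (E : V → ℕ) :
    PebStep G (C + E) (C' + E) := by
  obtain ⟨u, v, F, hadj, rfl, rfl⟩ := h.exists_eq_add
  rw [add_right_comm F (Pi.single u 2), add_right_comm F (Pi.single v 1)]
  exact pebStep_add_single hadj _

theorem pebMoves_add {C C' : V → ℕ} (h : Relation.ReflTransGen (PebStep G) C C') (E : V → ℕ) :
    Relation.ReflTransGen (PebStep G) (C + E) (C' + E) :=
  h.lift (· + E) fun _ _ h => h.add E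

theorem pebMoves_of_adj {u v : V} (h : G.Adj u v) (k : ℕ) (E : V → ℕ) :
    Relation.ReflTransGen (PebStep G) (E + Pi.single u (2 * k)) (E + Pi.single v k) := by
  induction k generalizing E with
  | zero => simpa using Relation.ReflTransGen.refl
  | succ k ih =>
    have h1 := ih (E + Pi.single u 2)
    have h2 := pebStep_add_single h (E + Pi.single v k)
    rw [add_right_comm, add_assoc, ← Pi.single_add] at h1
    rw [add_right_comm, add_assoc E (Pi.single v k) (Pi.single v 1), ← Pi.single_add] at h2
    rw [show 2 * (k + 1) = 2 * k + 2 by ring]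
    exact h1.tail h2

theorem pebMoves_of_walk {u v : V} (p : G.Walk u v) (E : V → ℕ) :
    Relation.ReflTransGen (PebStep G) (E + Pi.single u (2 ^ p.length)) (E + Pi.single v 1) := by
  induction p with
  | nil => exact .refl
  | cons h p ih =>
    rw [Walk.length_cons, pow_succ']
    exact (pebMoves_of_adj h _ E).trans ih

theorem Reaches.trans {C C' : V → ℕ} {r : V} (h : Relation.ReflTransGen (PebStep G) C C')
    (h' : Reaches G C' r) : Reaches G C r := by
  obtain ⟨D, h1, h2⟩ := h'
  exact ⟨D, h.trans h1, h2⟩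

theorem exists_eq_add_single {C : V → ℕ} {v : V} {k : ℕ} (h : k ≤ C v) :
    ∃ E : V → ℕ, C = E + Pi.single v k := by
  refine ⟨C - Pi.single v k, ?_⟩
  ext w
  by_cases hw : w = v
  · subst hw; simp; omega
  · simp [hw]

theorem reaches_of_pow_le {C : V → ℕ} {u r : V} {d : ℕ} (p : G.Walk u r) (hp : p.length ≤ d)
    (h : 2 ^ d ≤ C u) : Reaches G C r := by
  obtain ⟨E, rfl⟩ := exists_eq_add_single ((Nat.pow_le_pow_right two_pos hp).trans h)
  exact ⟨_, pebMoves_of_walk p E, by simp⟩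

theorem pebblingNumber_eq_card [Fintype V] [Nonempty V]
    (h : ∀ (r : V) (C : V → ℕ), ∑ v, C v = Fintype.card V → Reaches G C r) :
    pebblingNumber G = Fintype.card V := by
  refine le_antisymm (Nat.sInf_le h) (le_csInf ⟨_, h⟩ fun m hm => ?_)
  by_contra! hlt
  obtain ⟨r⟩ := ‹Nonempty V›
  obtain ⟨s, hs, hcard⟩ := Finset.exists_subset_card_eq (s := univ.erase r) (n := m)
    (by rw [card_erase_of_mem (mem_univ r), card_univ]; omega)
  obtain ⟨C', h1, h2⟩ := hm r (fun v => if v ∈ s then 1 else 0) (by simp [hcard])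
  have hr : r ∉ s := fun hr => by simpa using hs hr
  rcases h1.cases_head with rfl | ⟨D, ⟨u, v, -, h2, -⟩, -⟩
  · simp [hr] at h2
  · dsimp only at h2
    split_ifs at h2 <;> omega

/-- A single pile of fewer than `2 ^ d` pebbles does not reach a vertex at distance `d`. -/
theorem two_pow_dist_le_of_reaches [Fintype V] (hG : G.Connected) {x r : V} {m : ℕ}
    (h : Reaches G (Pi.single x m) r) : 2 ^ G.dist x r ≤ m := by
  obtain ⟨C', h1, h2⟩ := h
  let w : (V → ℕ) → ℝ := fun C => ∑ v, C v * (1 / 2 : ℝ) ^ G.dist v r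
  have hadd : ∀ C D, w (C + D) = w C + w D := fun C D => by
    simp only [w, Pi.add_apply, Nat.cast_add, add_mul, sum_add_distrib]
  have hsingle : ∀ v k, w (Pi.single v k) = k * (1 / 2 : ℝ) ^ G.dist v r := fun v k => by
    simp only [w]
    rw [Finset.sum_eq_single v (by intro b _ hb; simp [hb]) (by simp)]
    simp
  have hmono : ∀ {C C'}, Relation.ReflTransGen (PebStep G) C C' → w C' ≤ w C := by
    intro C C' h
    induction h with
    | refl => exact le_rfl
    | tail _ h ih =>
      refine le_trans ?_ ih
      obtain ⟨u, v, E, hadj, rfl, rfl⟩ := h.exists_eq_add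
      rw [hadd, hadd, hsingle, hsingle]
      have h3 : G.dist u r ≤ G.dist v r + 1 := by
        have := hG.dist_triangle (u := u) (v := v) (w := r)
        rw [dist_eq_one_iff_adj.2 hadj] at this
        omega
      have h4 : (1 / 2 : ℝ) ^ (G.dist v r + 1) ≤ (1 / 2 : ℝ) ^ G.dist u r :=
        pow_le_pow_of_le_one (by norm_num) (by norm_num) h3
      rw [pow_succ] at h4
      push_cast
      linarith
  have h3 := hmono h1
  have h4 : (1 : ℝ) ≤ w C' := by
    have : (C' r : ℝ) * (1 / 2 : ℝ) ^ G.dist r r ≤ w C' :=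
      Finset.single_le_sum (f := fun v => (C' v : ℝ) * (1 / 2 : ℝ) ^ G.dist v r)
        (fun _ _ => by positivity) (mem_univ r)
    have h5 : (1 : ℝ) ≤ C' r := by exact_mod_cast h2
    simp at this
    linarith
  rw [hsingle] at h3
  have h5 : (1 : ℝ) ≤ m * (1 / 2 : ℝ) ^ G.dist x r := h4.trans h3
  rw [one_div, inv_pow, ← div_eq_mul_inv, le_div_iff₀ (by positivity), one_mul] at h5
  exact_mod_cast h5

end Pebbling

section UpperBound

open scoped Classical

variable {G : SimpleGraph V}

theorem SimpleGraph.Connected.girth_le_two_mul_add_one (hG : G.Connected) (hc : ¬ G.IsAcyclic)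
    {D : ℕ} (hD : ∀ u v, G.dist u v ≤ D) : G.girth ≤ 2 * D + 1 := by
  simp only [IsAcyclic, not_forall, not_not] at hc
  obtain ⟨r, c, hc⟩ := hc
  obtain ⟨v, hv, hmax⟩ := Finset.exists_max_image c.support.toFinset (G.dist r) ⟨r, by simp⟩
  simp only [List.mem_toFinset] at hv hmax
  have hc' : (c.rotate v hv).IsCycle := hc.rotate hv
  have key : ∀ w ∈ c.support, G.Adj w v → ∃ (q : G.Walk r w) (h : G.Adj w v),
      (q.concat h).IsPath ∧ q.length = G.dist r w := by
    intro w hw hadj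
    obtain ⟨q, hq, hql⟩ := hG.exists_path_of_dist r w
    refine ⟨q, hadj, hq.concat (fun hvq => ?_) _, hql⟩
    have h1 := dist_le (q.takeUntil v hvq)
    have h2 := Walk.length_takeUntil_lt_length hvq hadj.ne'
    have h3 := hmax w hw
    omega
  have hfin : ∀ p q : G.Walk r v, p.IsPath → q.IsPath → p ≠ q → p.length + q.length ≤ 2 * D + 1 →
      G.girth ≤ 2 * D + 1 := by
    intro p q hp hq hne hl
    obtain ⟨_, _, _, _, h1, h2⟩ := hp.exists_isCycle_length_le_add_of_ne hq hne
    exact (girth_le_length h1).trans (h2.trans hl)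
  obtain ⟨p₀, hp₀, hl₀⟩ := hG.exists_path_of_dist r v
  have hDv := hD r v
  have mem : ∀ i, (c.rotate v hv).getVert i ∈ c.support := fun i =>
    (Walk.mem_support_rotate_iff c v hv).1 (Walk.getVert_mem_support _ i)
  obtain ⟨q₁, h₁, hq₁, hl₁⟩ := key (c.rotate v hv).snd (mem _) (Walk.adj_snd hc'.not_nil).symm
  obtain ⟨q₂, h₂, hq₂, hl₂⟩ := key (c.rotate v hv).penultimate (mem _)
    (Walk.adj_penultimate hc'.not_nil)
  have hm₁ : G.dist r (c.rotate v hv).snd ≤ G.dist r v := hmax _ (mem _)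
  have hm₂ : G.dist r (c.rotate v hv).penultimate ≤ G.dist r v := hmax _ (mem _)
  by_cases e₁ : q₁.length = G.dist r v
  · refine hfin _ _ hp₀ hq₁ (fun h => ?_) ?_
    · have := congrArg Walk.length h
      rw [Walk.length_concat] at this; omega
    · rw [Walk.length_concat]; omega
  by_cases e₂ : q₂.length = G.dist r v
  · refine hfin _ _ hp₀ hq₂ (fun h => ?_) ?_
    · have := congrArg Walk.length h
      rw [Walk.length_concat] at this; omega
    · rw [Walk.length_concat]; omega
  refine hfin _ _ hq₁ hq₂ (fun h => hc'.snd_ne_penultimate ?_) ?_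
  · have := congrArg Walk.penultimate h
    rwa [Walk.penultimate_concat, Walk.penultimate_concat] at this
  · rw [Walk.length_concat, Walk.length_concat]; omega

theorem two_pow_dist_le_card [Fintype V] (hG : G.Connected)
    (h : pebblingNumber G = Fintype.card V) (x r : V) : 2 ^ G.dist x r ≤ Fintype.card V := by
  have hpos : 0 < Fintype.card V := Fintype.card_pos_iff.2 ⟨x⟩
  have hne : {m : ℕ | ∀ (r : V) (C : V → ℕ), ∑ v, C v = m → Reaches G C r}.Nonempty := by
    by_contra hne
    rw [Set.not_nonempty_iff_eq_empty] at hne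
    rw [pebblingNumber, hne, Nat.sInf_empty] at h
    omega
  have hmem := Nat.sInf_mem hne
  rw [← pebblingNumber, h] at hmem
  exact two_pow_dist_le_of_reaches hG (hmem r (Pi.single x _) (by simp))

theorem girth_le_of_pebblingNumber_eq_card [Fintype V] (hG : G.Connected)
    (h : pebblingNumber G = Fintype.card V) (hc : ¬ G.IsAcyclic) :
    G.girth ≤ 2 * Nat.log 2 (Fintype.card V) + 1 :=
  hG.girth_le_two_mul_add_one hc fun u v =>
    Nat.le_log_of_pow_le one_lt_two (two_pow_dist_le_card hG h u v)

theorem mem_upperBounds_girthClass0 (n : ℕ) :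
    2 * Nat.log 2 n + 1 ∈ upperBounds {g : ℕ | ∃ m ≤ n, ∃ G : SimpleGraph (Fin m), G.Connected ∧
      pebblingNumber G = Fintype.card (Fin m) ∧ ¬ G.IsAcyclic ∧ g ≤ G.girth} := by
  rintro g ⟨m, hm, G, hG, hp, hc, hg⟩
  have h1 := girth_le_of_pebblingNumber_eq_card hG hp hc
  rw [Fintype.card_fin] at h1
  have h2 : Nat.log 2 m ≤ Nat.log 2 n := Nat.log_mono_right hm
  omega

theorem girthClass0_le (n : ℕ) : (girthClass0 n : ℝ) ≤ 1 + 2 * Real.logb 2 n := by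
  have h1 : girthClass0 n ≤ 2 * Nat.log 2 n + 1 := csSup_le' (mem_upperBounds_girthClass0 n)
  have h2 := Real.natLog_le_logb n 2
  have h3 : (girthClass0 n : ℝ) ≤ 2 * Nat.log 2 n + 1 := by exact_mod_cast h1
  push_cast at h2
  linarith

end UpperBound

section Routing

open scoped Classical

variable {G : SimpleGraph V}

theorem pebMoves_sum {ι : Type*} (s : Finset ι) {f g : ι → V → ℕ}
    (h : ∀ i ∈ s, Relation.ReflTransGen (PebStep G) (f i) (g i)) :
    Relation.ReflTransGen (PebStep G) (∑ i ∈ s, f i) (∑ i ∈ s, g i) := by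
  induction s using Finset.induction_on with
  | empty => exact .refl
  | insert a s ha ih =>
    rw [sum_insert ha, sum_insert ha]
    have h1 := pebMoves_add (h a (mem_insert_self _ _)) (∑ i ∈ s, f i)
    have h2 := pebMoves_add (ih fun i hi => h i (mem_insert_of_mem hi)) (g a)
    rw [add_comm, add_comm _ (g a)] at h2
    exact h1.trans h2

/-- Pebbles can be routed along the chains of a matching: the demand `i` at `pos i` is served by
`τ i`, either a donor giving up two pebbles or a vertex with a single pebble, which is then served
by its own match under `σ`. -/
theorem exists_pebMoves_of_matching {ι : Type*} [Fintype ι] (P : V → Prop) (O : Finset V)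
    (pos τ : ι → V) (σ : V → V) (hτ : ∀ i, G.Adj (τ i) (pos i))
    (hτO : ∀ i, P (τ i) → τ i ∈ O)
    (hσ : ∀ o ∈ O, σ o = o ∨ G.Adj (σ o) o) (hO : ∀ o ∈ O, P o)
    (hσO : ∀ o ∈ O, P (σ o) → σ o ∈ O)
    (hττ : ∀ i j, P (τ i) → τ i = τ j → i = j)
    (hσσ : ∀ o ∈ O, ∀ o' ∈ O, P (σ o) → σ o = σ o' → o = o')
    (hτσ : ∀ i, ∀ o ∈ O, P (τ i) → τ i ≠ σ o) :
    ∃ E : V → ℕ, Relation.ReflTransGen (PebStep G)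
      (∑ o ∈ O, Pi.single o 1 + ∑ i, (if P (τ i) then 0 else Pi.single (τ i) 2) +
        ∑ o ∈ O, (if P (σ o) then 0 else Pi.single (σ o) 2))
      (E + ∑ i, Pi.single (pos i) 1) := by
  induction hn : O.card generalizing O pos τ with
  | zero =>
    rw [card_eq_zero] at hn
    subst hn
    refine ⟨0, ?_⟩
    simp only [sum_empty, zero_add, add_zero]
    refine pebMoves_sum _ fun i _ => ?_
    rw [if_neg fun h => by simpa using hτO i h]
    simpa using pebMoves_of_adj (hτ i) 1 0
  | succ n ih =>
    by_cases hP : ∃ i, P (τ i)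
    · obtain ⟨i, hi⟩ := hP
      have hp := hτO i hi
      have hσp : P (σ (τ i)) → σ (τ i) ≠ τ i := fun _ h => hτσ i _ hp hi h.symm
      obtain ⟨E, hE⟩ := ih (O.erase (τ i)) (Function.update pos i (τ i))
        (Function.update τ i (σ (τ i))) (fun j => by
          by_cases hj : j = i
          · subst hj
            simp only [Function.update_self]
            rcases hσ _ hp with h | h
            · exact absurd h (hσp (by rw [h]; exact hi))
            · exact h
          · simp [hj, hτ j])
        (fun j hj => by
          by_cases hji : j = i
          · subst hji
            simp only [Function.update_self] at hj ⊢
            exact mem_erase.2 ⟨hσp hj, hσO _ hp hj⟩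
          · simp only [Function.update_of_ne hji] at hj ⊢
            exact mem_erase.2 ⟨fun h => hji (hττ _ _ hj h), hτO _ hj⟩)
        (fun o ho => hσ o (mem_of_mem_erase ho)) (fun o ho => hO o (mem_of_mem_erase ho))
        (fun o ho h => mem_erase.2 ⟨(hτσ i o (mem_of_mem_erase ho) hi).symm,
          hσO o (mem_of_mem_erase ho) h⟩)
        (fun j k hj hjk => by
          by_cases hji : j = i <;> by_cases hki : k = i
          · rw [hji, hki]
          · subst hji
            simp only [Function.update_self, Function.update_of_ne hki] at hj hjk
            exact absurd hjk.symm (hτσ k _ hp (hjk ▸ hj))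
          · subst hki
            simp only [Function.update_self, Function.update_of_ne hji] at hj hjk
            exact absurd hjk (hτσ j _ hp hj)
          · simp only [Function.update_of_ne hki, Function.update_of_ne hji] at hj hjk
            exact hττ j k hj hjk)
        (fun o ho o' ho' => hσσ o (mem_of_mem_erase ho) o' (mem_of_mem_erase ho'))
        (fun j o ho hj => by
          by_cases hji : j = i
          · subst hji
            simp only [Function.update_self] at hj ⊢
            intro h
            exact (mem_erase.1 ho).1 (hσσ _ hp _ (mem_of_mem_erase ho) hj h).symm
          · simp only [Function.update_of_ne hji] at hj ⊢
            exact hτσ j o (mem_of_mem_erase ho) hj)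
        (by rw [card_erase_of_mem hp, hn]; rfl)
      refine ⟨E, ?_⟩
      have h1 := pebMoves_add hE (Pi.single (τ i) 1)
      rw [← add_sum_erase univ _ (mem_univ i), ← add_sum_erase univ _ (mem_univ i)] at h1
      rw [← add_sum_erase univ _ (mem_univ i), ← add_sum_erase univ _ (mem_univ i),
        ← add_sum_erase O _ hp, ← add_sum_erase O _ hp, if_pos hi]
      simp only [Function.update_self] at h1
      have e1 : ∑ x ∈ univ.erase i, (if P (Function.update τ i (σ (τ i)) x) then (0 : V → ℕ)
          else Pi.single (Function.update τ i (σ (τ i)) x) 2) =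
          ∑ x ∈ univ.erase i, if P (τ x) then 0 else Pi.single (τ x) 2 :=
        sum_congr rfl fun j hj => by rw [Function.update_of_ne (ne_of_mem_erase hj)]
      have e2 : ∑ x ∈ univ.erase i, (Pi.single (Function.update pos i (τ i) x) 1 : V → ℕ) =
          ∑ x ∈ univ.erase i, Pi.single (pos x) 1 :=
        sum_congr rfl fun j hj => by rw [Function.update_of_ne (ne_of_mem_erase hj)]
      rw [e1, e2] at h1
      have h2 := pebStep_add_single (hτ i)
        (E + ∑ x ∈ univ.erase i, (Pi.single (pos x) 1 : V → ℕ))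
      rw [show (2 : ℕ) = 1 + 1 from rfl, Pi.single_add] at h2
      have h3 : PebStep G
          (E + (Pi.single (τ i) 1 + ∑ x ∈ univ.erase i, Pi.single (pos x) 1) + Pi.single (τ i) 1)
          (E + (Pi.single (pos i) 1 + ∑ x ∈ univ.erase i, Pi.single (pos x) 1)) := by
        convert h2 using 1 <;> abel
      convert h1.tail h3 using 1
      abel
    · push Not at hP
      refine ⟨∑ o ∈ O, Pi.single o 1 +
        ∑ o ∈ O, (if P (σ o) then 0 else Pi.single (σ o) 2), ?_⟩
      have h1 : Relation.ReflTransGen (PebStep G)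
          (∑ i, (if P (τ i) then 0 else Pi.single (τ i) 2)) (∑ i, Pi.single (pos i) 1) :=
        pebMoves_sum _ fun i _ => by
          rw [if_neg (hP i)]
          simpa using pebMoves_of_adj (hτ i) 1 0
      have h2 := pebMoves_add h1 (∑ o ∈ O, Pi.single o 1 +
        ∑ o ∈ O, (if P (σ o) then 0 else Pi.single (σ o) 2))
      convert h2 using 1 <;> abel

/-- The outer vertex boundary of a finite set of vertices. -/
noncomputable def outerBoundary [Fintype V] (G : SimpleGraph V) (A : Finset V) : Finset V :=
  univ.filter fun v => v ∉ A ∧ ∃ a ∈ A, G.Adj a v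

theorem mem_outerBoundary [Fintype V] {A : Finset V} {v : V} :
    v ∈ outerBoundary G A ↔ v ∉ A ∧ ∃ a ∈ A, G.Adj a v := by
  simp [outerBoundary]

/-- The number of pebbles that a vertex holding `c` pebbles can contribute to a routing. -/
def routeCap (c : ℕ) : ℕ := if c = 1 then 1 else c / 2

theorem routing_alternative [Fintype V] {C : V → ℕ} {x : V} (hx : C x = 0) (m : ℕ) :
    (∃ C', Relation.ReflTransGen (PebStep G) C C' ∧ m ≤ C' x) ∨
      ∃ A : Finset V, x ∈ A ∧ (∀ a ∈ A, a ≠ x → C a = 1) ∧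
        ∑ v ∈ outerBoundary G A, routeCap (C v) < m := by
  let slots : Finset V → Finset (Σ _ : V, ℕ) := fun s => s.sigma fun v => range (routeCap (C v))
  let N : V → Finset V := fun v => univ.filter (G.Adj v)
  let t : Fin m ⊕ {o // C o = 1} → Finset (Σ _ : V, ℕ) :=
    Sum.elim (fun _ => slots (N x)) fun o => slots (insert o.1 (N o.1))
  by_cases hall : ∀ S : Finset (Fin m ⊕ {o // C o = 1}), S.card ≤ (S.biUnion t).card
  · left
    obtain ⟨f, hf, hft⟩ := (all_card_le_biUnion_card_iff_exists_injective t).1 hall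
    have hcap : ∀ l, (f l).2 < routeCap (C (f l).1) := by
      rintro (i | o)
      · have := hft (Sum.inl i)
        simp only [t, slots, Sum.elim_inl, mem_sigma, mem_range] at this
        exact this.2
      · have := hft (Sum.inr o)
        simp only [t, slots, Sum.elim_inr, mem_sigma, mem_range] at this
        exact this.2
    have hinj : ∀ l l', C (f l).1 = 1 → (f l).1 = (f l').1 → l = l' := by
      intro l l' h1 h2
      apply hf
      have h3 := hcap l
      have h4 := hcap l'
      rw [← h2] at h4
      simp only [routeCap, if_pos h1] at h3 h4
      exact Sigma.ext h2 (heq_of_eq (by omega))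
    let σ : V → V := fun v => if h : C v = 1 then (f (Sum.inr ⟨v, h⟩)).1 else v
    have hσ : ∀ o (h : C o = 1), σ o = (f (Sum.inr ⟨o, h⟩)).1 := fun o h => dif_pos h
    let O : Finset V := univ.filter fun v => C v = 1
    have hO : ∀ {o}, o ∈ O ↔ C o = 1 := by simp [O]
    obtain ⟨E, hE⟩ := exists_pebMoves_of_matching (G := G) (fun v => C v = 1) O
      (fun _ : Fin m => x) (fun i => (f (Sum.inl i)).1) σ
      (fun i => by
        have := hft (Sum.inl i)
        simp only [t, slots, N, Sum.elim_inl, mem_sigma, mem_filter] at this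
        exact this.1.2.symm)
      (fun i hi => hO.2 hi)
      (fun o ho => by
        have := hft (Sum.inr ⟨o, hO.1 ho⟩)
        simp only [t, slots, N, Sum.elim_inr, mem_sigma, mem_filter, mem_insert] at this
        rw [hσ o (hO.1 ho)]
        exact this.1.imp id fun h => h.2.symm)
      (fun o ho => hO.1 ho) (fun o _ h => hO.2 h)
      (fun i j hi hij => Sum.inl_injective (hinj _ _ hi hij))
      (fun o ho o' ho' h1 h2 => by
        rw [hσ o (hO.1 ho)] at h1 h2
        rw [hσ o' (hO.1 ho')] at h2
        have := Sum.inr_injective (hinj _ _ h1 h2)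
        exact congrArg Subtype.val this)
      (fun i o ho h1 h2 => by
        rw [hσ o (hO.1 ho)] at h2
        simpa using hinj _ _ h1 h2)
    set C₀ : V → ℕ := ∑ o ∈ O, Pi.single o 1 +
      ∑ i, (if C (f (Sum.inl i)).1 = 1 then 0 else Pi.single (f (Sum.inl i)).1 2) +
        ∑ o ∈ O, (if C (σ o) = 1 then 0 else Pi.single (σ o) 2) with hC₀
    have hle : C₀ ≤ C := by
      have e : C₀ = ∑ o ∈ O, Pi.single o 1 + ∑ l : Fin m ⊕ {o // C o = 1},
          (if C (f l).1 = 1 then 0 else Pi.single (f l).1 2) := by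
        rw [hC₀, add_assoc, Fintype.sum_sum_type]
        congr 2
        rw [Finset.sum_subtype O (p := fun o => C o = 1) (fun _ => hO)]
        exact Finset.sum_congr rfl fun o _ => by rw [hσ o.1 o.2]
      rw [e]
      intro v
      rw [Pi.add_apply, Finset.sum_apply, Finset.sum_apply]
      have e1 : ∑ o ∈ O, (Pi.single o 1 : V → ℕ) v = if C v = 1 then 1 else 0 := by
        simp [Pi.single_apply, hO]
      rw [e1]
      by_cases hv : C v = 1
      · have e0 : ∀ l, ((if C (f l).1 = 1 then 0 else Pi.single (f l).1 2 : V → ℕ)) v = 0 := by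
          intro l
          by_cases h : C (f l).1 = 1
          · rw [if_pos h]; rfl
          · have hne : v ≠ (f l).1 := fun h' => h (h' ▸ hv)
            rw [if_neg h, Pi.single_eq_of_ne hne]
        rw [if_pos hv, hv, sum_eq_zero fun l _ => e0 l, add_zero]
      · rw [if_neg hv, zero_add]
        have e2 : ∑ l : Fin m ⊕ {o // C o = 1},
            ((if C (f l).1 = 1 then 0 else Pi.single (f l).1 2 : V → ℕ)) v =
            2 * (univ.filter fun l => (f l).1 = v).card := by
          rw [card_filter, mul_sum]
          refine sum_congr rfl fun l _ => ?_
          by_cases hl : (f l).1 = v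
          · rw [if_pos hl, hl, if_neg hv]; simp
          · rw [if_neg hl]
            split_ifs
            · rfl
            · simp [Ne.symm hl]
        have e3 : (univ.filter fun l => (f l).1 = v).card ≤ (range (C v / 2)).card := by
          refine card_le_card_of_injOn (fun l => (f l).2) (fun l hl => ?_) ?_
          · have hl : (f l).1 = v := by simpa using hl
            have := hcap l
            rw [hl, routeCap, if_neg hv] at this
            simpa using this
          · intro l hl l' hl' h
            have hl : (f l).1 = v := by simpa using hl
            have hl' : (f l').1 = v := by simpa using hl'
            exact hf (Sigma.ext (hl.trans hl'.symm) (heq_of_eq h))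
        rw [card_range] at e3
        rw [e2]
        exact (Nat.mul_le_mul_left 2 e3).trans (Nat.mul_div_le _ _)
    obtain ⟨D, hD⟩ := exists_add_of_le hle
    have hE' : Relation.ReflTransGen (PebStep G) C₀ (E + ∑ _i : Fin m, Pi.single x 1) := by
      convert hE
    have h := pebMoves_add hE' D
    rw [← hD] at h
    refine ⟨_, h, ?_⟩
    simp
    omega
  · right
    push Not at hall
    obtain ⟨S, hS⟩ := hall
    let S₁ : Finset V := univ.filter fun v => ∃ h : C v = 1, Sum.inr ⟨v, h⟩ ∈ S
    have hS₁ : ∀ v ∈ S₁, C v = 1 := fun v hv => (mem_filter.1 hv).2.1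
    have hcardS : S.card ≤ S.toLeft.card + S₁.card := by
      rw [← card_toLeft_add_card_toRight (u := S)]
      refine Nat.add_le_add_left ?_ _
      refine card_le_card_of_injOn Subtype.val (fun o ho => ?_) Subtype.val_injective.injOn
      have ho : Sum.inr o ∈ S := by simpa using ho
      exact mem_coe.2 (mem_filter.2 ⟨mem_univ _, o.2, ho⟩)
    have hslots : ∀ s, (slots s).card = ∑ v ∈ s, routeCap (C v) := fun s => by
      simp [slots]
    have hone : ∑ v ∈ S₁, routeCap (C v) = S₁.card := by
      rw [card_eq_sum_ones]
      exact sum_congr rfl fun v hv => by rw [hS₁ v hv]; rfl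
    have hsub₁ : ∀ v ∈ S₁, slots (insert v (N v)) ⊆ S.biUnion t := by
      intro v hv
      obtain ⟨h, hv⟩ := (mem_filter.1 hv).2
      exact subset_biUnion_of_mem t hv
    have hmem : ∀ {s q}, q ∈ slots s ↔ q.1 ∈ s ∧ q.2 < routeCap (C q.1) := by
      simp [slots]
    obtain ⟨i, hi⟩ : S.toLeft.Nonempty := by
      rw [nonempty_iff_ne_empty]
      intro h0
      rw [h0, card_empty, zero_add, ← hone, ← hslots] at hcardS
      refine absurd (hcardS.trans (card_le_card ?_)) (not_le.2 hS)
      intro q hq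
      rw [hmem] at hq
      exact hsub₁ q.1 hq.1 (hmem.2 ⟨mem_insert_self _ _, hq.2⟩)
    have hxS : x ∉ S₁ := fun h => by simpa [hx] using hS₁ x h
    refine ⟨insert x S₁, mem_insert_self _ _, fun a ha hax =>
      hS₁ a ((mem_insert.1 ha).resolve_left hax), ?_⟩
    have hsub : slots (S₁ ∪ outerBoundary G (insert x S₁)) ⊆ S.biUnion t := by
      intro q hq
      rw [hmem, mem_union, mem_outerBoundary] at hq
      obtain ⟨hq | ⟨-, a, ha, hadj⟩, hq2⟩ := hq
      · exact hsub₁ q.1 hq (hmem.2 ⟨mem_insert_self _ _, hq2⟩)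
      · rcases mem_insert.1 ha with rfl | ha
        · exact subset_biUnion_of_mem t (mem_toLeft.1 hi) (hmem.2 ⟨by simp [N, hadj], hq2⟩)
        · exact hsub₁ a ha (hmem.2 ⟨by simp [N, hadj], hq2⟩)
    have h1 := card_le_card hsub
    rw [hslots, sum_union, hone] at h1
    · have h2 : S.toLeft.card ≤ m := by simpa using card_le_univ S.toLeft
      omega
    · rw [Finset.disjoint_left]
      intro v hv hv'
      exact (mem_outerBoundary.1 hv').1 (mem_insert_of_mem hv)

end Routing

section Connectivity

open scoped Classical

variable {G : SimpleGraph V}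

/-- Every nonempty set of vertices that does not dominate the graph has at least `k` outer
neighbours; this is `k`-connectivity up to the trivial cases. -/
def BoundaryConnected [Fintype V] (G : SimpleGraph V) (k : ℕ) : Prop :=
  ∀ A : Finset V, A.Nonempty → A ∪ outerBoundary G A ≠ univ → k ≤ (outerBoundary G A).card

/-- A greedy independent set, weighted by `w`, in a digraph with bounded weighted out-degrees. -/
theorem exists_independent_of_sum_le (R : V → V → Prop) (w : V → ℕ) (M : ℕ) (D : Finset V)
    (hw : ∀ v ∈ D, 0 < w v) (hM : ∀ v ∈ D, w v ≤ M)
    (hR : ∀ u ∈ D, ∑ v ∈ D.filter (R u), w v ≤ M) :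
    ∃ I ⊆ D, (∀ u ∈ I, ∀ v ∈ I, u ≠ v → ¬ R u v) ∧ ∑ v ∈ D, w v ≤ 3 * M * I.card := by
  induction hn : D.card using Nat.strong_induction_on generalizing D with
  | _ n ih =>
  rcases D.eq_empty_or_nonempty with rfl | hD
  · exact ⟨∅, by simp, by simp, by simp⟩
  obtain ⟨v, hv, hvM⟩ : ∃ v ∈ D, ∑ u ∈ D.filter (R · v), w u ≤ M := by
    by_contra! h
    have h1 : ∑ v ∈ D, w v * M < ∑ v ∈ D, w v * ∑ u ∈ D.filter (R · v), w u :=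
      sum_lt_sum_of_nonempty hD fun v hv => Nat.mul_lt_mul_of_pos_left (h v hv) (hw v hv)
    have h2 : ∑ v ∈ D, w v * ∑ u ∈ D.filter (R · v), w u =
        ∑ u ∈ D, w u * ∑ v ∈ D.filter (R u), w v := by
      simp only [mul_sum, sum_filter]
      rw [sum_comm]
      refine sum_congr rfl fun u _ => sum_congr rfl fun v _ => ?_
      split_ifs <;> ring
    have h3 : ∑ u ∈ D, w u * ∑ v ∈ D.filter (R u), w v ≤ ∑ u ∈ D, w u * M :=
      sum_le_sum fun u hu => Nat.mul_le_mul_left _ (hR u hu)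
    omega
  let D' := D.filter fun u => u ≠ v ∧ ¬ R v u ∧ ¬ R u v
  have hD' : D' ⊆ D := filter_subset _ _
  have hvD' : v ∉ D' := by simp [D']
  obtain ⟨I, hI, hind, hsum⟩ := ih D'.card
    (hn ▸ card_lt_card ((ssubset_iff_of_subset hD').2 ⟨v, hv, hvD'⟩)) D'
    (fun u hu => hw u (hD' hu)) (fun u hu => hM u (hD' hu))
    (fun u hu => (sum_le_sum_of_subset (filter_subset_filter _ hD')).trans (hR u (hD' hu))) rfl
  have hmem : ∀ u ∈ I, u ≠ v ∧ ¬ R v u ∧ ¬ R u v := fun u hu => (mem_filter.1 (hI hu)).2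
  have hvI : v ∉ I := fun h => (hmem v h).1 rfl
  refine ⟨insert v I, insert_subset hv (hI.trans hD'), ?_, ?_⟩
  · intro a ha b hb hab
    rcases mem_insert.1 ha with hav | haI <;> rcases mem_insert.1 hb with hbv | hbI
    · exact absurd (hav.trans hbv.symm) hab
    · exact hav ▸ (hmem b hbI).2.1
    · exact hbv ▸ (hmem a haI).2.2
    · exact hind a haI b hbI hab
  · have hcover : D ⊆ D' ∪ ({v} ∪ (D.filter (R v) ∪ D.filter (R · v))) := by
      intro u hu
      simp only [D', mem_union, mem_filter, mem_singleton]
      tauto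
    have h1 := sum_le_sum_of_subset (f := w) hcover
    have h2 : ∀ s t : Finset V, ∑ x ∈ s ∪ t, w x ≤ ∑ x ∈ s, w x + ∑ x ∈ t, w x := fun s t => by
      rw [← sum_union_inter]; exact Nat.le_add_right _ _
    have h3 := h2 D' ({v} ∪ (D.filter (R v) ∪ D.filter (R · v)))
    have h4 := h2 {v} (D.filter (R v) ∪ D.filter (R · v))
    have h5 := h2 (D.filter (R v)) (D.filter (R · v))
    rw [sum_singleton] at h4
    have h6 := hR v hv
    have h7 := hM v hv
    rw [card_insert_of_notMem hvI, mul_add, mul_one]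
    omega

theorem routeCap_pos {c : ℕ} (h : c ≠ 0) : 0 < routeCap c := by
  unfold routeCap; split_ifs <;> omega

theorem routeCap_le (c : ℕ) : routeCap c ≤ c := by
  unfold routeCap; split_ifs <;> omega

theorem sub_one_le_two_mul_routeCap (c : ℕ) : c - 1 ≤ 2 * routeCap c := by
  unfold routeCap; split_ifs <;> omega

theorem exists_cut_minimal [Fintype V] (w : V → ℕ) (P : V → Prop) (x : V) (A₀ : Finset V)
    (hx : x ∈ A₀) (hA₀ : ∀ a ∈ A₀, a ≠ x → P a) :
    ∃ A : Finset V, x ∈ A ∧ (∀ a ∈ A, a ≠ x → P a) ∧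
      ∑ v ∈ outerBoundary G A, w v ≤ ∑ v ∈ outerBoundary G A₀, w v ∧
      ∀ B : Finset V, x ∈ B → (∀ a ∈ B, a ≠ x → P a) →
        ∑ v ∈ outerBoundary G A, w v ≤ ∑ v ∈ outerBoundary G B, w v ∧
        (∑ v ∈ outerBoundary G B, w v ≤ ∑ v ∈ outerBoundary G A, w v → A.card ≤ B.card) := by
  let φ : Finset V → ℕ := fun A =>
    (∑ v ∈ outerBoundary G A, w v) * (Fintype.card V + 1) + A.card
  obtain ⟨A, hA, hmin⟩ := Finset.exists_min_image
    (univ.filter fun A : Finset V => x ∈ A ∧ ∀ a ∈ A, a ≠ x → P a) φ ⟨A₀, by simp [hx]; simpa using hA₀⟩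
  obtain ⟨-, hxA, hPA⟩ := mem_filter.1 hA
  have key : ∀ B : Finset V, x ∈ B → (∀ a ∈ B, a ≠ x → P a) →
      ∑ v ∈ outerBoundary G A, w v ≤ ∑ v ∈ outerBoundary G B, w v ∧
      (∑ v ∈ outerBoundary G B, w v ≤ ∑ v ∈ outerBoundary G A, w v → A.card ≤ B.card) := by
    intro B hxB hPB
    have h : φ A ≤ φ B := hmin B (mem_filter.2 ⟨mem_univ _, hxB, hPB⟩)
    simp only [φ] at h
    have hB := card_le_univ B
    constructor
    · by_contra! hlt
      have := Nat.mul_le_mul_right (Fintype.card V + 1) (Nat.succ_le_of_lt hlt)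
      rw [Nat.succ_mul] at this
      omega
    · intro hle
      have := Nat.mul_le_mul_right (Fintype.card V + 1) hle
      omega
  exact ⟨A, hxA, hPA, (key A₀ hx hA₀).1, key⟩

theorem reaches_of_boundaryConnected [Fintype V] {k d : ℕ} (hk : BoundaryConnected G k)
    (hd : ∀ u v, ∃ p : G.Walk u v, p.length ≤ d) (hkd : 7 * (2 ^ d) ^ 2 ≤ k)
    {C : V → ℕ} (hC : ∑ v, C v = Fintype.card V) (r : V) : Reaches G C r := by
  by_contra hr
  have hMpos : 0 < 2 ^ d := by positivity
  generalize hM : 2 ^ d = M at *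
  have hbig : ∀ C₀ ≤ C, ∀ C', Relation.ReflTransGen (PebStep G) C₀ C' → ∀ x, C' x < M := by
    intro C₀ hle C' hmov x
    by_contra! h
    obtain ⟨E, rfl⟩ := exists_add_of_le hle
    obtain ⟨p, hp⟩ := hd x r
    refine hr (Reaches.trans (pebMoves_add hmov E) (reaches_of_pow_le p hp ?_))
    rw [hM]
    exact h.trans (Nat.le_add_right _ _)
  have hCM : ∀ x, C x < M := hbig C le_rfl C .refl
  set cap : V → ℕ := fun v => routeCap (C v) with hcap
  have hcapM : ∀ v, cap v < M := fun v => (routeCap_le _).trans_lt (hCM v)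
  have hcap1 : ∀ v, C v ≠ 0 → 0 < cap v := fun v h => routeCap_pos h
  have hcut : ∀ x, ∃ A : Finset V, x ∈ A ∧ (∀ a ∈ A, a ≠ x → C a = 1) ∧
      ∑ v ∈ outerBoundary G A, cap v < M := by
    intro x
    have hle : Function.update C x 0 ≤ C := by
      intro v
      by_cases h : v = x
      · subst h; simp
      · simp [h]
    rcases routing_alternative (G := G) (C := Function.update C x 0) (x := x) (by simp) M with
      ⟨C', h1, h2⟩ | ⟨A, h1, h2, h3⟩
    · exact absurd (hbig _ hle _ h1 x) (not_lt.2 h2)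
    · refine ⟨A, h1, fun a ha hax => ?_, ?_⟩
      · simpa [hax] using h2 a ha hax
      · rwa [sum_congr rfl fun v hv => ?_]
        have : v ≠ x := fun h => (mem_outerBoundary.1 hv).1 (h ▸ h1)
        simp [this, hcap]
  choose A₀ hxA₀ hPA₀ hA₀M using hcut
  choose A hxA hPA hAA₀ hAmin using fun x =>
    exists_cut_minimal (G := G) cap (fun a => C a = 1) x (A₀ x) (hxA₀ x) (hPA₀ x)
  have hAM : ∀ x, ∑ v ∈ outerBoundary G (A x), cap v < M := fun x => (hAA₀ x).trans_lt (hA₀M x)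
  set Z : Finset V := univ.filter fun v => C v = 0 with hZ
  set D : Finset V := univ.filter fun v => 2 ≤ C v with hD
  have hmZ : ∀ {v}, v ∈ Z ↔ C v = 0 := by simp [hZ]
  have hmD : ∀ {v}, v ∈ D ↔ 2 ≤ C v := by simp [hD]
  have hrC : C r = 0 := by
    by_contra h
    exact hr ⟨C, .refl, by omega⟩
  have hrZ : r ∈ Z := hmZ.2 hrC
  have hzD : Z.card = ∑ v ∈ D, (C v - 1) := by
    have h1 : ∑ v, (C v + if C v = 0 then 1 else 0) =
        ∑ v, (1 + if 2 ≤ C v then C v - 1 else 0) :=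
      sum_congr rfl fun v _ => by split_ifs <;> omega
    rw [sum_add_distrib, sum_add_distrib, hC, ← card_eq_sum_ones, card_univ, ← sum_filter,
      ← sum_filter, ← card_eq_sum_ones] at h1
    convert Nat.add_left_cancel h1
  have hzcap : Z.card ≤ 2 * ∑ v ∈ D, cap v := by
    rw [hzD, mul_sum]
    exact sum_le_sum fun v _ => sub_one_le_two_mul_routeCap _
  have hzpos : 0 < Z.card := card_pos.2 ⟨r, hrZ⟩
  have hDne : D.Nonempty := by
    rw [nonempty_iff_ne_empty]
    rintro h
    rw [h, sum_empty] at hzcap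
    omega
  have hMM : M ≤ M ^ 2 := by rw [sq]; exact Nat.le_mul_self M
  have hkz : k ≤ Z.card := by
    rcases routing_alternative (G := G) hrC 1 with ⟨C', h1, h2⟩ | ⟨B, h1, h2, h3⟩
    · exact absurd ⟨C', h1, h2⟩ hr
    · have h3 : ∑ v ∈ outerBoundary G B, cap v < 1 := h3
      have hB : outerBoundary G B ⊆ Z := by
        intro v hv
        rw [hmZ]
        by_contra h
        have := single_le_sum (f := cap) (fun _ _ => Nat.zero_le _) hv
        have := hcap1 v h
        omega
      refine (hk B ⟨r, h1⟩ fun h => ?_).trans (card_le_card hB)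
      obtain ⟨u, hu⟩ := hDne
      rw [hmD] at hu
      rcases mem_union.1 (h ▸ mem_univ u) with h | h
      · by_cases hur : u = r
        · subst hur; omega
        · have := h2 u h hur; omega
      · have := hmZ.1 (hB h); omega
  have hnotmem : ∀ u ∈ D, ∀ x, u ≠ x → u ∉ A x := fun u hu x hux h => by
    have := hPA x u h hux
    rw [hmD] at hu
    omega
  have hdisj : ∀ u ∈ D, ∀ u' ∈ D, u ≠ u' → u ∉ outerBoundary G (A u') →
      u' ∉ outerBoundary G (A u) → Disjoint (A u) (A u') := by
    intro u hu u' hu' hne h1 h2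
    have hsub : ∀ X Y : Finset V, outerBoundary G (X \ (Y ∪ outerBoundary G Y)) ⊆
        (outerBoundary G Y).filter (· ∈ X) ∪ (outerBoundary G X).filter (· ∉ Y) := by
      intro X Y v hv
      rw [mem_outerBoundary] at hv
      obtain ⟨hv, a, ha, hav⟩ := hv
      simp only [mem_sdiff, mem_union, mem_outerBoundary, mem_filter, not_or, not_and,
        not_exists] at hv ha ⊢
      have hvY : v ∉ Y := fun h => ha.2.2 ha.2.1 v h hav.symm
      by_cases hvX : v ∈ X
      · left
        by_contra hcon
        exact hv hvX hvY fun _ y hy hyv => hcon ⟨⟨hvY, y, hy, hyv⟩, hvX⟩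
      · exact Or.inr ⟨⟨hvX, a, ha.1, hav⟩, hvY⟩
    have hbound : ∀ X Y : Finset V,
        ∑ v ∈ outerBoundary G (X \ (Y ∪ outerBoundary G Y)), cap v ≤
        ∑ v ∈ (outerBoundary G Y).filter (· ∈ X), cap v +
          ∑ v ∈ (outerBoundary G X).filter (· ∉ Y), cap v := fun X Y =>
      (sum_le_sum_of_subset (hsub X Y)).trans
        (by rw [← sum_union_inter]; exact Nat.le_add_right _ _)
    have b1 := hbound (A u) (A u')
    have b2 := hbound (A u') (A u)
    have s1 := sum_filter_add_sum_filter_not (outerBoundary G (A u)) (· ∈ A u') cap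
    have s2 := sum_filter_add_sum_filter_not (outerBoundary G (A u')) (· ∈ A u) cap
    have m1 := hAmin u (A u \ (A u' ∪ outerBoundary G (A u')))
      (by simp [hxA, h1, hnotmem u hu u' hne])
      (fun a ha => hPA u a (mem_sdiff.1 ha).1)
    have m2 := hAmin u' (A u' \ (A u ∪ outerBoundary G (A u)))
      (by simp [hxA, h2, hnotmem u' hu' u hne.symm])
      (fun a ha => hPA u' a (mem_sdiff.1 ha).1)
    have heq := eq_of_subset_of_card_le sdiff_subset (m1.2 (by omega))
    rw [Finset.disjoint_left]
    intro a ha ha'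
    rw [← heq] at ha
    exact (mem_sdiff.1 ha).2 (mem_union_left _ ha')
  have hNZ : ∀ u ∈ D, k ≤ ((outerBoundary G (A u)).filter (· ∈ Z)).card + M := by
    intro u hu
    have hne : A u ∪ outerBoundary G (A u) ≠ univ := by
      intro h
      have hsub : D ⊆ insert u (outerBoundary G (A u)) := by
        intro v hv
        rw [mem_insert]
        by_cases hvu : v = u
        · exact Or.inl hvu
        · exact Or.inr ((mem_union.1 (h ▸ mem_univ v)).resolve_left (hnotmem v hv u hvu))
      have h1 := sum_le_sum_of_subset (f := cap) hsub
      have hu' : u ∉ outerBoundary G (A u) := fun h => (mem_outerBoundary.1 h).1 (hxA u)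
      rw [sum_insert hu'] at h1
      have := hAM u
      have := hcapM u
      omega
    have h1 := hk (A u) ⟨u, hxA u⟩ hne
    rw [← card_filter_add_card_filter_not (· ∈ Z)] at h1
    have h2 : ((outerBoundary G (A u)).filter (· ∉ Z)).card ≤
        ∑ v ∈ outerBoundary G (A u), cap v := by
      rw [card_eq_sum_ones]
      refine (sum_le_sum fun v hv => ?_).trans (sum_le_sum_of_subset (filter_subset _ _))
      exact hcap1 v fun h => (mem_filter.1 hv).2 (hmZ.2 h)
    have := hAM u
    omega
  obtain ⟨I, hID, hind, hIsum⟩ := exists_independent_of_sum_le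
    (fun u v => v ∈ outerBoundary G (A u)) cap M D
    (fun v hv => hcap1 v (by have := hmD.1 hv; omega)) (fun v _ => (hcapM v).le)
    (fun u _ => (sum_le_sum_of_subset fun v hv => by simp at hv; exact hv.2).trans (hAM u).le)
  obtain ⟨x, hxZ, hxJ⟩ : ∃ x ∈ Z, M ≤ (I.filter fun u => x ∈ outerBoundary G (A u)).card := by
    by_contra! h
    have h1 : ∑ x ∈ Z, (I.filter fun u => x ∈ outerBoundary G (A u)).card < ∑ x ∈ Z, M :=
      sum_lt_sum_of_nonempty ⟨r, hrZ⟩ h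
    have h2 : ∑ u ∈ I, (k - M) ≤ ∑ u ∈ I, (Z.filter fun x => x ∈ outerBoundary G (A u)).card :=
      sum_le_sum fun u hu => by
        have h3 := hNZ u (hID hu)
        have h4 : (outerBoundary G (A u)).filter (· ∈ Z) =
            Z.filter fun x => x ∈ outerBoundary G (A u) := by
          ext v; simp [and_comm]
        rw [h4] at h3
        omega
    have h3 : ∑ x ∈ Z, (I.filter fun u => x ∈ outerBoundary G (A u)).card =
        ∑ u ∈ I, (Z.filter fun x => x ∈ outerBoundary G (A u)).card :=
      sum_card_bipartiteAbove_eq_sum_card_bipartiteBelow _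
    rw [h3] at h1
    rw [sum_const, smul_eq_mul] at h1 h2
    have h4 : I.card * (k - M) < 6 * M * I.card * M := by
      refine (h2.trans_lt h1).trans_le (Nat.mul_le_mul_right _ ?_)
      calc Z.card ≤ 2 * ∑ v ∈ D, cap v := hzcap
        _ ≤ 2 * (3 * M * I.card) := Nat.mul_le_mul_left _ hIsum
        _ = _ := by ring
    have h5 : k - M < 6 * M ^ 2 := by
      by_contra! h5
      have := Nat.mul_le_mul_left I.card h5
      have e : I.card * (6 * M ^ 2) = 6 * M * I.card * M := by ring
      omega
    omega
  have hxC := hmZ.1 hxZ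
  have hmeet : ∀ u ∈ I.filter fun u => x ∈ outerBoundary G (A u),
      ∃ v ∈ A u, v ∈ outerBoundary G (A₀ x) := by
    intro u hu
    obtain ⟨huI, hxu⟩ := mem_filter.1 hu
    by_contra! h
    have huC := hmD.1 (hID huI)
    have huA : u ∉ A₀ x := fun hux => by
      have : u ≠ x := by rintro rfl; omega
      have := hPA₀ x u hux this
      omega
    obtain ⟨-, a, ha, hax⟩ := mem_outerBoundary.1 hxu
    have haA : a ∈ A₀ x := by
      by_contra haA
      exact h a ha (mem_outerBoundary.2 ⟨haA, x, hxA₀ x, hax.symm⟩)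
    have hsub : outerBoundary G (A u \ A₀ x) ⊆ outerBoundary G (A u) := by
      intro v hv
      obtain ⟨hv, b, hb, hbv⟩ := mem_outerBoundary.1 hv
      rw [mem_sdiff] at hb
      refine mem_outerBoundary.2 ⟨fun hvA => ?_, b, hb.1, hbv⟩
      have hvx : v ∈ A₀ x := by
        by_contra hvx
        exact hv (mem_sdiff.2 ⟨hvA, hvx⟩)
      exact h b hb.1 (mem_outerBoundary.2 ⟨hb.2, v, hvx, hbv.symm⟩)
    have h1 := (hAmin u (A u \ A₀ x) (mem_sdiff.2 ⟨hxA u, huA⟩)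
      fun a ha => hPA u a (mem_sdiff.1 ha).1).2 (sum_le_sum_of_subset hsub)
    have h2 : A u \ A₀ x ⊂ A u := (ssubset_iff_of_subset sdiff_subset).2
      ⟨a, ha, fun h => (mem_sdiff.1 h).2 haA⟩
    exact absurd h1 (not_le.2 (card_lt_card h2))
  choose! f hfA hfN using hmeet
  have hinj : Set.InjOn f (I.filter fun u => x ∈ outerBoundary G (A u) : Finset V) := by
    intro u hu u' hu' hf
    by_contra hne
    have huI := (mem_filter.1 hu).1
    have huI' := (mem_filter.1 hu').1
    have := hdisj u (hID huI) u' (hID huI') hne (hind u' huI' u huI (Ne.symm hne))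
      (hind u huI u' huI' hne)
    exact Finset.disjoint_left.1 this (hfA u hu) (hf ▸ hfA u' hu')
  have h1 : (I.filter fun u => x ∈ outerBoundary G (A u)).card ≤
      ∑ v ∈ outerBoundary G (A₀ x), cap v := by
    calc _ ≤ ∑ u ∈ I.filter fun u => x ∈ outerBoundary G (A u), cap (f u) := by
          rw [card_eq_sum_ones]
          refine sum_le_sum fun u hu => hcap1 _ fun h => ?_
          have huC := hmD.1 (hID (mem_filter.1 hu).1)
          by_cases hfu : f u = u
          · rw [hfu] at h; omega
          · have := hPA u _ (hfA u hu) hfu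
            omega
      _ = ∑ v ∈ (I.filter fun u => x ∈ outerBoundary G (A u)).image f, cap v :=
          (sum_image hinj).symm
      _ ≤ _ := sum_le_sum_of_subset (image_subset_iff.2 hfN)
  have := hA₀M x
  omega

end Connectivity

section Extension

open scoped Classical

variable {G : SimpleGraph V}

theorem SimpleGraph.Walk.exists_eq_append_cons {u v x y : V} (c : G.Walk u v) (h : G.Adj x y)
    (hmem : (⟨(x, y), h⟩ : G.Dart) ∈ c.darts) :
    ∃ (q : G.Walk u x) (p : G.Walk y v), c = q.append (.cons h p) := by
  induction c with
  | nil => simp at hmem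
  | @cons u w v hadj c ih =>
    rw [Walk.darts_cons, List.mem_cons] at hmem
    rcases hmem with heq | hmem
    · obtain ⟨h1, h2⟩ : x = u ∧ y = w := by simpa using heq
      subst h1 h2
      exact ⟨.nil, c, rfl⟩
    · obtain ⟨q, p, rfl⟩ := ih hmem
      exact ⟨.cons hadj q, p, rfl⟩

/-- Adding an edge between two vertices that are far apart creates no short cycle. -/
theorem le_egirth_sup_edge {u v : V} {g : ℕ} (hG : (g : ℕ∞) ≤ G.egirth)
    (h : ∀ p : G.Walk u v, g ≤ p.length + 1) : (g : ℕ∞) ≤ (G ⊔ edge u v).egirth := by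
  rw [le_egirth] at hG ⊢
  intro a c hc
  have hedge : ∀ {x y} (p : (G ⊔ edge u v).Walk x y), s(u, v) ∉ p.edges →
      ∀ e ∈ p.edges, e ∈ G.edgeSet := by
    intro x y p hp e he
    have h1 := p.edges_subset_edgeSet he
    induction e with
    | _ b d =>
    rw [mem_edgeSet, sup_adj, edge_adj] at h1
    rcases h1 with h1 | ⟨⟨rfl, rfl⟩ | ⟨rfl, rfl⟩, -⟩
    · exact h1
    · exact absurd he hp
    · exact absurd (Sym2.eq_swap ▸ he) hp
  by_cases hmem : s(u, v) ∈ c.edges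
  · obtain ⟨⟨⟨x, y⟩, hxy⟩, hd, hdeq⟩ := List.mem_map.1 hmem
    obtain ⟨q, p, rfl⟩ := c.exists_eq_append_cons hxy hd
    have hnodup := hc.isCircuit.isTrail.edges_nodup
    have hdeq : s(x, y) = s(u, v) := hdeq
    rw [Walk.edges_append, Walk.edges_cons, List.nodup_append] at hnodup
    have hp : s(u, v) ∉ (p.append q).edges := by
      rw [← hdeq, Walk.edges_append, List.mem_append]
      rintro (h1 | h1)
      · exact (List.nodup_cons.1 hnodup.2.1).1 h1
      · exact hnodup.2.2 _ h1 _ (List.mem_cons_self ..) rfl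
    let w := (p.append q).transfer G (hedge _ hp)
    have hw : w.length = p.length + q.length := by simp [w]
    have hlen : g ≤ w.length + 1 := by
      rcases Sym2.eq_iff.1 hdeq with ⟨rfl, rfl⟩ | ⟨rfl, rfl⟩
      · simpa using h w.reverse
      · exact h w
    rw [Walk.length_append, Walk.length_cons]
    exact_mod_cast (by omega : g ≤ q.length + (p.length + 1))
  · simpa using hG a _ (hc.transfer (hedge c hmem))

theorem exists_extension_of_le_egirth [Finite V] {g : ℕ} (hg : 3 ≤ g) (hG : (g : ℕ∞) ≤ G.egirth) :
    ∃ H, G ≤ H ∧ (g : ℕ∞) ≤ H.egirth ∧ ∀ u v, ∃ p : H.Walk u v, p.length ≤ g - 2 := by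
  obtain ⟨H, hGH, hH⟩ := Finite.exists_le_maximal (p := fun H : SimpleGraph V =>
    (g : ℕ∞) ≤ H.egirth) hG
  refine ⟨H, hGH, hH.prop, fun u v => ?_⟩
  by_contra! h
  have huv : u ≠ v := by
    rintro rfl
    simpa using h .nil
  have h1 := hH.le_of_ge (le_egirth_sup_edge hH.prop fun p => by have := h p; omega) le_sup_left
  have hadj : H.Adj u v := h1 (by simp [edge_adj, huv])
  have h2 := h hadj.toWalk
  rw [Walk.length_cons, Walk.length_nil] at h2
  omega

theorem BoundaryConnected.mono [Fintype V] {H : SimpleGraph V} {k : ℕ} (hGH : G ≤ H)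
    (hG : BoundaryConnected G k) : BoundaryConnected H k := by
  intro A hA hne
  have hsub : outerBoundary G A ⊆ outerBoundary H A := by
    intro v hv
    rw [mem_outerBoundary] at hv ⊢
    exact ⟨hv.1, hv.2.imp fun a ha => ⟨ha.1, hGH ha.2⟩⟩
  refine (hG A hA fun h => hne ?_).trans (card_le_card hsub)
  exact eq_univ_of_forall fun v => union_subset_union_right hsub (h ▸ mem_univ v)

theorem outerBoundary_map [Fintype V] {W : Type*} [Fintype W] {H : SimpleGraph W} (f : G ≃g H)
    (A : Finset V) : outerBoundary H (A.map f.toEquiv.toEmbedding) =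
      (outerBoundary G A).map f.toEquiv.toEmbedding := by
  ext w
  obtain ⟨v, rfl⟩ := f.toEquiv.surjective w
  change f.toEquiv.toEmbedding v ∈ _ ↔ f.toEquiv.toEmbedding v ∈ _
  rw [Finset.mem_map' f.toEquiv.toEmbedding, mem_outerBoundary, mem_outerBoundary]
  refine and_congr (not_congr (Finset.mem_map' f.toEquiv.toEmbedding))
    ⟨fun ⟨a, ha, hadj⟩ => ?_, fun ⟨a, ha, hadj⟩ => ?_⟩
  · obtain ⟨b, hb, rfl⟩ := Finset.mem_map.1 ha
    exact ⟨b, hb, f.map_adj_iff.1 hadj⟩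
  · exact ⟨f a, Finset.mem_map_of_mem f.toEquiv.toEmbedding ha, f.map_adj_iff.2 hadj⟩

theorem BoundaryConnected.map_iso [Fintype V] {W : Type*} [Fintype W] {H : SimpleGraph W} {k : ℕ}
    (hG : BoundaryConnected G k) (f : G ≃g H) : BoundaryConnected H k := by
  intro A hA hne
  obtain ⟨B, rfl⟩ : ∃ B : Finset V, A = B.map f.toEquiv.toEmbedding :=
    ⟨A.map f.toEquiv.symm.toEmbedding, by ext; simp⟩
  rw [outerBoundary_map, card_map]
  refine hG B (by simpa using hA) fun h => hne ?_
  rw [outerBoundary_map, ← map_union, h, map_univ_equiv]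

theorem BoundaryConnected.not_isAcyclic [Fintype V] {k : ℕ} (hk : BoundaryConnected G k)
    (hk2 : 2 ≤ k) (hV : 3 ≤ Fintype.card V) (hG : G.Connected) : ¬ G.IsAcyclic := by
  intro hac
  have : Nontrivial V := Fintype.one_lt_card_iff_nontrivial.1 (by omega)
  obtain ⟨v, hv⟩ := IsTree.exists_vert_degree_one_of_nontrivial (G := G) ⟨hG, hac⟩
  have hb : outerBoundary G {v} = G.neighborFinset v := by
    ext w
    simp only [mem_outerBoundary, mem_singleton, exists_eq_left, mem_neighborFinset]
    exact ⟨fun h => h.2, fun h => ⟨h.ne', h⟩⟩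
  have hcard : (outerBoundary G {v}).card = 1 := by rw [hb]; exact hv
  have h1 := hk {v} (singleton_nonempty v) fun h => by
    have := card_union_le {v} (outerBoundary G {v})
    rw [h, card_univ, hcard, card_singleton] at this
    omega
  omega

theorem exists_class0_of_boundaryConnected [Fintype V] {g : ℕ} (hg : 4 ≤ g)
    (hG : (g : ℕ∞) ≤ G.egirth) (hk : BoundaryConnected G (2 ^ (2 * g - 1)))
    (hV : 3 ≤ Fintype.card V) :
    ∃ H : SimpleGraph V, H.Connected ∧ pebblingNumber H = Fintype.card V ∧ ¬ H.IsAcyclic ∧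
      g ≤ H.girth := by
  obtain ⟨H, hGH, hH, hd⟩ := exists_extension_of_le_egirth (by omega) hG
  have hkH := hk.mono hGH
  have : Nonempty V := Fintype.card_pos_iff.1 (by omega)
  have hconn : H.Connected := ⟨fun u v => (hd u v).elim fun p _ => ⟨p⟩⟩
  have hcyc : ¬ H.IsAcyclic := hkH.not_isAcyclic
    (le_self_pow₀ one_le_two (by omega)) hV hconn
  refine ⟨H, hconn, pebblingNumber_eq_card fun r C hC =>
    reaches_of_boundaryConnected hkH hd ?_ hC r, hcyc, ?_⟩
  · obtain ⟨j, rfl⟩ := Nat.exists_eq_add_of_le hg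
    have h8 : 2 ^ (2 * (4 + j) - 1) = 8 * (2 ^ (4 + j - 2)) ^ 2 := by
      rw [← pow_mul, show 2 * (4 + j) - 1 = 3 + (4 + j - 2) * 2 by omega, pow_add]
      rfl
    rw [h8]
    exact Nat.mul_le_mul_right _ (by norm_num)
  · rw [girth, ← ENat.natCast_le_natCast, ENat.natCast_toNat (by rwa [Ne, egirth_eq_top])]
    exact hH

end Extension

section Atoms

open scoped Classical

variable [Fintype V] {G : SimpleGraph V}

theorem card_outerBoundary_inter_add_union_le (A B : Finset V) :
    (outerBoundary G (A ∩ B)).card + (outerBoundary G (A ∪ B)).card ≤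
      (outerBoundary G A).card + (outerBoundary G B).card := by
  rw [← card_union_add_card_inter, ← card_union_add_card_inter (outerBoundary G A)]
  refine Nat.add_le_add (card_le_card fun x hx => ?_) (card_le_card fun x hx => ?_)
  · simp only [mem_union, mem_inter, mem_outerBoundary] at hx ⊢
    grind
  · simp only [mem_union, mem_inter, mem_outerBoundary] at hx ⊢
    grind

theorem outerBoundary_compl_subset (A : Finset V) :
    outerBoundary G (univ \ (A ∪ outerBoundary G A)) ⊆ outerBoundary G A := by
  intro x hx
  simp only [mem_outerBoundary, mem_sdiff, mem_univ, true_and, mem_union, not_or] at hx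
  obtain ⟨hx, b, ⟨hbA, hbN⟩, hb⟩ := hx
  by_contra hxN
  rw [mem_outerBoundary] at hxN
  by_cases hxA : x ∈ A
  · exact hbN ⟨hbA, x, hxA, hb.symm⟩
  · exact hx ⟨hxA, hxN⟩

/-- Distinct smallest fragments with smallest boundary are disjoint. -/
theorem eq_of_inter_nonempty_of_minimal {A B : Finset V} (hA : A ∪ outerBoundary G A ≠ univ)
    (hmin : ∀ D : Finset V, D.Nonempty → D ∪ outerBoundary G D ≠ univ →
      (outerBoundary G A).card ≤ (outerBoundary G D).card ∧
        ((outerBoundary G D).card = (outerBoundary G A).card → A.card ≤ D.card))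
    (hBc : B.card = A.card) (hBN : (outerBoundary G B).card = (outerBoundary G A).card)
    (hAB : (A ∩ B).Nonempty) : A = B := by
  by_contra hne
  have hlt : (A ∩ B).card < A.card := by
    refine card_lt_card (inter_subset_left.ssubset_of_ne fun h => hne ?_)
    exact eq_of_subset_of_card_le (inter_eq_left.1 h) hBc.le
  have hsub := card_outerBoundary_inter_add_union_le (G := G) A B
  have hI := hmin (A ∩ B) hAB fun h => hA <| eq_univ_of_forall fun x => by
    have hx : x ∈ A ∩ B ∪ outerBoundary G (A ∩ B) := h ▸ mem_univ x
    simp only [mem_union, mem_inter, mem_outerBoundary] at hx ⊢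
    grind
  have hIlt : (outerBoundary G A).card < (outerBoundary G (A ∩ B)).card := by
    by_contra! h
    have := hI.2 (le_antisymm h hI.1)
    omega
  have hU : A ∪ B ∪ outerBoundary G (A ∪ B) = univ := by
    by_contra h
    have := (hmin (A ∪ B) (hAB.mono fun x hx => mem_union_left _ (mem_inter.1 hx).1) h).1
    omega
  have hcU := card_union_le (A ∪ B) (outerBoundary G (A ∪ B))
  rw [hU] at hcU
  have hcAB := card_union_add_card_inter A B
  have hpos := hAB.card_pos
  have hcA := card_sdiff_add_card_eq_card (subset_univ (A ∪ outerBoundary G A))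
  rw [card_union_of_disjoint (Finset.disjoint_left.2 fun a ha h =>
    (mem_outerBoundary.1 h).1 ha)] at hcA
  have hstar := hmin (univ \ (A ∪ outerBoundary G A)) (by
    rw [sdiff_nonempty]
    exact fun h => hA (univ_subset_iff.1 h)) (by
    obtain ⟨a, ha⟩ := hAB
    intro h
    have h1 : a ∈ _ := h ▸ mem_univ a
    have haA := (mem_inter.1 ha).1
    rcases mem_union.1 h1 with h1 | h1
    · exact (mem_sdiff.1 h1).2 (mem_union_left _ haA)
    · exact (mem_outerBoundary.1 (outerBoundary_compl_subset A h1)).1 haA)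
  have := hstar.2 (le_antisymm (card_le_card (outerBoundary_compl_subset A)) hstar.1)
  omega

/-- A connected edge-transitive graph is as connected as its minimum degree allows. -/
theorem boundaryConnected_of_edgeTransitive {k : ℕ} (hG : G.Preconnected)
    (hT : ∀ a b c d, G.Adj a b → G.Adj c d →
      ∃ f : G ≃g G, (f a = c ∧ f b = d) ∨ (f a = d ∧ f b = c))
    (hk : ∀ v, k ≤ (outerBoundary G {v}).card) : BoundaryConnected G k := by
  intro A₀ hA₀ hA₀'
  let S : Finset (Finset V) := univ.filter fun D => D.Nonempty ∧ D ∪ outerBoundary G D ≠ univ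
  obtain ⟨A₁, hA₁, hmin₁⟩ := S.exists_min_image (fun D => (outerBoundary G D).card)
    ⟨A₀, by simp [S, hA₀, hA₀']⟩
  let S' := S.filter fun D => (outerBoundary G D).card = (outerBoundary G A₁).card
  obtain ⟨A, hA, hmin₂⟩ := S'.exists_min_image Finset.card ⟨A₁, by simp [S', hA₁]⟩
  obtain ⟨hAS, hAN⟩ := mem_filter.1 hA
  obtain ⟨-, hAne, hAU⟩ := mem_filter.1 hAS
  have hmin : ∀ D : Finset V, D.Nonempty → D ∪ outerBoundary G D ≠ univ →
      (outerBoundary G A).card ≤ (outerBoundary G D).card ∧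
        ((outerBoundary G D).card = (outerBoundary G A).card → A.card ≤ D.card) := by
    intro D hD hDU
    have hDS : D ∈ S := mem_filter.2 ⟨mem_univ _, hD, hDU⟩
    exact ⟨hAN ▸ hmin₁ D hDS, fun h => hmin₂ D (mem_filter.2 ⟨hDS, h.trans hAN⟩)⟩
  refine le_trans ?_ (hmin A₀ hA₀ hA₀').1
  obtain ⟨v, hv⟩ := hAne
  refine (hk v).trans (card_le_card fun w hw => ?_)
  simp only [mem_outerBoundary, mem_singleton, exists_eq_left] at hw
  refine mem_outerBoundary.2 ⟨fun hwA => ?_, v, hv, hw.2⟩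
  have hclosed : ∀ c d, G.Adj c d → c ∈ A → d ∈ A := by
    intro c d hcd hc
    obtain ⟨f, hf⟩ := hT v w c d hw.2 hcd
    have hfA : c ∈ A.map f.toEquiv.toEmbedding ∧ d ∈ A.map f.toEquiv.toEmbedding := by
      have h1 := mem_map_of_mem f.toEquiv.toEmbedding hv
      have h2 := mem_map_of_mem f.toEquiv.toEmbedding hwA
      rcases hf with ⟨rfl, rfl⟩ | ⟨rfl, rfl⟩
      · exact ⟨h1, h2⟩
      · exact ⟨h2, h1⟩
    rw [eq_of_inter_nonempty_of_minimal hAU hmin (card_map f.toEquiv.toEmbedding)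
      (by rw [outerBoundary_map, card_map]) ⟨c, mem_inter.2 ⟨hc, hfA.1⟩⟩]
    exact hfA.2
  refine hAU (eq_univ_of_forall fun x => mem_union_left _ ?_)
  obtain ⟨p⟩ := hG v x
  clear hw hwA
  induction p with
  | nil => exact hv
  | cons h p ih => exact ih (hclosed _ _ h hv)

end Atoms

section CosetGraph

open scoped Classical

variable {Γ : Type*} [Group Γ] (H : Bool → Subgroup Γ)

/-- The coset of `H b` through `γ`, as a vertex of the coset graph. -/
def cosetVertex (b : Bool) (γ : Γ) : Σ b, Γ ⧸ H b := ⟨b, γ⟩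

/-- The incidence graph of the left cosets of two subgroups, adjacent when they intersect. -/
def cosetGraph : SimpleGraph (Σ b, Γ ⧸ H b) where
  Adj x y := ∃ b γ, x = cosetVertex H b γ ∧ y = cosetVertex H (!b) γ
  symm := ⟨by
    rintro _ _ ⟨b, γ, rfl, rfl⟩
    exact ⟨!b, γ, rfl, by rw [Bool.not_not]⟩⟩
  loopless := ⟨by
    rintro _ ⟨b, γ, rfl, h⟩
    simpa [cosetVertex] using congrArg Sigma.fst h⟩

/-- Alternating products of `n` nontrivial elements of the two subgroups, beginning with an
element of `H b`. -/
inductive IsAltProd : Bool → ℕ → Γ → Prop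
  | one (b) : IsAltProd b 0 1
  | mul {b n s γ} : s ∈ H b → s ≠ 1 → IsAltProd (!b) n γ → IsAltProd b (n + 1) (s * γ)

variable {H}

theorem exists_cosetVertex (x : Σ b, Γ ⧸ H b) : ∃ b γ, x = cosetVertex H b γ := by
  obtain ⟨b, x⟩ := x
  obtain ⟨γ, rfl⟩ := QuotientGroup.mk_surjective x
  exact ⟨b, γ, rfl⟩

theorem cosetVertex_eq_iff {b : Bool} {γ γ' : Γ} :
    cosetVertex H b γ = cosetVertex H b γ' ↔ γ⁻¹ * γ' ∈ H b := by
  rw [← QuotientGroup.eq, cosetVertex, cosetVertex, Sigma.mk.injEq]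
  simp

theorem cosetVertex_mul {b : Bool} {γ s : Γ} (hs : s ∈ H b) :
    cosetVertex H b (γ * s) = cosetVertex H b γ := by
  rw [eq_comm, cosetVertex_eq_iff, inv_mul_cancel_left]
  exact hs

theorem cosetGraph_adj (b : Bool) (γ : Γ) :
    (cosetGraph H).Adj (cosetVertex H b γ) (cosetVertex H (!b) γ) :=
  ⟨b, γ, rfl, rfl⟩

theorem cosetGraph_edgeTransitive (u v x y : Σ b, Γ ⧸ H b) (huv : (cosetGraph H).Adj u v)
    (hxy : (cosetGraph H).Adj x y) :
    ∃ f : cosetGraph H ≃g cosetGraph H, (f u = x ∧ f v = y) ∨ (f u = y ∧ f v = x) := by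
  obtain ⟨b, γ, rfl, rfl⟩ := huv
  obtain ⟨c, δ, rfl, rfl⟩ := hxy
  have hmul : ∀ (ε : Γ) (b : Bool) (γ : Γ),
    ε • cosetVertex H b γ = cosetVertex H b (ε * γ) := fun _ _ _ => rfl
  have hadj : ∀ (ε : Γ) (u v : Σ b, Γ ⧸ H b), (cosetGraph H).Adj u v →
      (cosetGraph H).Adj (ε • u) (ε • v) := by
    rintro ε _ _ ⟨b, γ, rfl, rfl⟩
    exact ⟨b, ε * γ, hmul .., hmul ..⟩
  refine ⟨⟨MulAction.toPerm (δ * γ⁻¹), fun {u v} => ⟨fun h => ?_, hadj _ u v⟩⟩, ?_⟩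
  · have h1 := hadj (δ * γ⁻¹)⁻¹ _ _ h
    rwa [MulAction.toPerm_apply, MulAction.toPerm_apply, inv_smul_smul, inv_smul_smul] at h1
  · have h : ∀ b, (δ * γ⁻¹) • cosetVertex H b γ = cosetVertex H b δ := fun b => by
      rw [hmul, inv_mul_cancel_right]
    rcases Bool.eq_or_eq_not b c with rfl | rfl
    · exact .inl ⟨h _, h _⟩
    · exact .inr ⟨h _, (h _).trans (by rw [Bool.not_not])⟩

theorem cosetGraph_preconnected (hH : H false ⊔ H true = ⊤) : (cosetGraph H).Preconnected := by
  let S : Subgroup Γ :=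
    { carrier := {γ | ∀ δ, (cosetGraph H).Reachable (cosetVertex H false δ)
        (cosetVertex H false (δ * γ))}
      one_mem' := fun δ => by rw [mul_one]
      mul_mem' := fun {γ γ'} h h' δ => by
        rw [← mul_assoc]
        exact (h δ).trans (h' _)
      inv_mem' := fun {γ} h δ => by
        simpa using (h (δ * γ⁻¹)).symm }
  have hS : (⊤ : Subgroup Γ) ≤ S := by
    rw [← hH]
    refine sup_le (fun s hs δ => ?_) (fun s hs δ => ?_)
    · rw [cosetVertex_mul hs]
    · have h1 := (cosetGraph_adj (H := H) false δ).reachable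
      have h2 := (cosetGraph_adj (H := H) true (δ * s)).reachable
      rw [cosetVertex_mul hs] at h2
      exact h1.trans h2
  have key : ∀ x, (cosetGraph H).Reachable (cosetVertex H false 1) x := by
    intro x
    obtain ⟨b, γ, rfl⟩ := exists_cosetVertex x
    have h1 := hS (Subgroup.mem_top γ) 1
    rw [one_mul] at h1
    cases b
    · exact h1
    · exact h1.trans (cosetGraph_adj (H := H) false γ).reachable
  exact fun x y => (key x).symm.trans (key y)

theorem card_le_card_outerBoundary_cosetGraph [Finite Γ] [Fintype (Σ b, Γ ⧸ H b)]
    (hH : ∀ b, H b ⊓ H (!b) = ⊥) (b : Bool) (γ : Γ) :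
    Nat.card (H b) ≤ (outerBoundary (cosetGraph H) {cosetVertex H b γ}).card := by
  have := Fintype.ofFinite (H b)
  rw [Nat.card_eq_fintype_card, ← card_univ]
  refine card_le_card_of_injOn (fun s => cosetVertex H (!b) (γ * s)) (fun s _ => ?_) ?_
  · have h := cosetGraph_adj (H := H) b (γ * s)
    rw [cosetVertex_mul s.2] at h
    rw [mem_coe, mem_outerBoundary]
    exact ⟨fun h' => h.ne' (mem_singleton.1 h'), _, mem_singleton_self _, h⟩
  · intro s _ t _ hst
    have h := cosetVertex_eq_iff.1 hst
    rw [mul_inv_rev, mul_assoc, inv_mul_cancel_left] at h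
    have h1 : (s : Γ)⁻¹ * t ∈ H b ⊓ H (!b) := ⟨(H b).mul_mem ((H b).inv_mem s.2) t.2, h⟩
    rw [hH, Subgroup.mem_bot, inv_mul_eq_one] at h1
    exact Subtype.ext h1

theorem exists_isAltProd_of_isTrail {v w : Σ b, Γ ⧸ H b} (p : (cosetGraph H).Walk v w)
    (b : Bool) (γ : Γ) (hv : v = cosetVertex H b γ) (hp : p.IsTrail)
    (hvp : s(v, cosetVertex H (!b) γ) ∉ p.edges) :
    ∃ δ, IsAltProd H b p.length δ ∧
      w = cosetVertex H (b ^^ p.length.bodd) (γ * δ) := by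
  induction p generalizing b γ with
  | nil => exact ⟨1, .one b, by simpa using hv⟩
  | @cons v x w h p ih =>
    rw [Walk.isTrail_cons] at hp
    obtain ⟨c, δ, rfl, rfl⟩ := id h
    obtain rfl : c = b := congrArg Sigma.fst hv
    rw [eq_comm, cosetVertex_eq_iff] at hv
    obtain ⟨ε, hε, hw⟩ := ih (!c) δ rfl hp.1 (by
      rw [Bool.not_not, Sym2.eq_swap]
      exact hp.2)
    refine ⟨γ⁻¹ * δ * ε, .mul hv (fun h1 => hvp ?_) hε, ?_⟩
    · obtain rfl := inv_mul_eq_one.1 h1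
      exact List.mem_cons_self
    · rw [Walk.length_cons, Nat.bodd_succ, mul_assoc, mul_inv_cancel_left]
      refine hw.trans ?_
      rw [Bool.not_xor, Bool.xor_not]

theorem le_egirth_cosetGraph {g : ℕ} (hH : ∀ b n γ, IsAltProd H b n γ → n.bodd →
    n + 1 < g → γ ∉ H (!b)) : (g : ℕ∞) ≤ (cosetGraph H).egirth := by
  rw [le_egirth]
  intro x c hc
  cases c with
  | nil => exact absurd hc Walk.not_isCycle_nil
  | @cons _ y _ h p =>
    obtain ⟨hp, hxy⟩ := (Walk.cons_isCycle_iff p h).1 hc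
    obtain ⟨b, γ, rfl, rfl⟩ := id h
    obtain ⟨δ, hδ, heq⟩ := exists_isAltProd_of_isTrail p (!b) γ rfl hp.isTrail (by
      rwa [Bool.not_not, Sym2.eq_swap])
    have hb : b = ((!b) ^^ p.length.bodd) := congrArg Sigma.fst heq
    have hodd : p.length.bodd = true := by
      revert hb
      cases b <;> cases p.length.bodd <;> simp
    rw [← hb, cosetVertex_eq_iff, inv_mul_cancel_left] at heq
    by_contra! hlt
    refine hH _ _ _ hδ hodd (ENat.natCast_lt_natCast.1 hlt) ?_
    rwa [Bool.not_not]

theorem boundaryConnected_cosetGraph [Finite Γ] [Fintype (Σ b, Γ ⧸ H b)] {k : ℕ}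
    (htop : H false ⊔ H true = ⊤) (hbot : ∀ b, H b ⊓ H (!b) = ⊥)
    (hk : ∀ b, k ≤ Nat.card (H b)) : BoundaryConnected (cosetGraph H) k := by
  refine boundaryConnected_of_edgeTransitive (cosetGraph_preconnected htop)
    cosetGraph_edgeTransitive fun v => ?_
  obtain ⟨b, γ, rfl⟩ := exists_cosetVertex v
  exact (hk b).trans (card_le_card_outerBoundary_cosetGraph hbot b γ)

theorem card_cosetGraph_le [Finite Γ] : Nat.card (Σ b, Γ ⧸ H b) ≤ 2 * Nat.card Γ := by
  rw [two_mul, ← Nat.card_sum]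
  refine Nat.card_le_card_of_surjective
    (Sum.elim (cosetVertex H false) (cosetVertex H true)) fun x => ?_
  obtain ⟨b, γ, rfl⟩ := exists_cosetVertex x
  cases b
  · exact ⟨.inl γ, rfl⟩
  · exact ⟨.inr γ, rfl⟩

end CosetGraph

theorem IsAltProd.exists_mul_eq {Γ : Type*} [Group Γ] {H : Bool → Subgroup Γ} {b : Bool} {m n : ℕ}
    {γ : Γ} (h : IsAltProd H b (m + n) γ) :
    ∃ c δ ε, IsAltProd H b m δ ∧ IsAltProd H c n ε ∧ δ * ε = γ := by
  induction m generalizing b γ with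
  | zero => exact ⟨b, 1, γ, .one b, by rwa [zero_add] at h, one_mul γ⟩
  | succ m ih =>
    rw [Nat.add_right_comm] at h
    cases h with
    | mul hs hs1 h =>
      obtain ⟨c, δ, ε, hδ, hε, rfl⟩ := ih h
      exact ⟨c, _, ε, .mul hs hs1 hδ, hε, mul_assoc ..⟩

section ShiftGroup

variable {F : Type*} [Field F] {D : ℕ}

/-- The nilpotent shift of coordinates. -/
def coordShift (F : Type*) [Field F] (D : ℕ) : Module.End F (Fin (D + 1) → F) where
  toFun v i := if 0 < i.val then v ⟨i - 1, by omega⟩ else 0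
  map_add' v w := by
    funext i
    simp only [Pi.add_apply]
    split_ifs <;> simp
  map_smul' a v := by
    funext i
    simp only [Pi.smul_apply]
    split_ifs <;> simp

theorem coordShift_apply (v : Fin (D + 1) → F) (i : Fin (D + 1)) :
    coordShift F D v i = if 0 < i.val then v ⟨i - 1, by omega⟩ else 0 := rfl

/-- Add `a` times each coordinate to the following one, when that one has parity `b`. -/
def parityTransvection (D : ℕ) (b : Bool) (a : F) : Module.End F (Fin (D + 1) → F) where
  toFun v i := v i + if i.val.bodd = b then a * coordShift F D v i else 0
  map_add' v w := by
    ext i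
    by_cases h : i.val.bodd = b <;> simp [h]
    ring
  map_smul' c v := by
    ext i
    by_cases h : i.val.bodd = b <;> simp [h]
    ring

theorem parityTransvection_apply (b : Bool) (a : F) (v : Fin (D + 1) → F) (i : Fin (D + 1)) :
    parityTransvection D b a v i =
      v i + if i.val.bodd = b then a * coordShift F D v i else 0 := rfl

theorem coordShift_parityTransvection (b : Bool) (a : F) (v : Fin (D + 1) → F) (i : Fin (D + 1))
    (hi : i.val.bodd = b) : coordShift F D (parityTransvection D b a v) i = coordShift F D v i := by
  rw [coordShift_apply, coordShift_apply]
  split_ifs with h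
  · obtain ⟨i, hi'⟩ := i
    obtain ⟨k, rfl⟩ : ∃ k, i = k + 1 := ⟨i - 1, by simp at h; omega⟩
    rw [parityTransvection_apply, if_neg, add_zero]
    rw [← hi]
    simp
  · rfl

/-- The parity transvections as a homomorphism from the additive group of the field. -/
def parityTransvectionHom (F : Type*) [Field F] (D : ℕ) (b : Bool) :
    Multiplicative F →* Module.End F (Fin (D + 1) → F) where
  toFun a := parityTransvection D b a.toAdd
  map_one' := by
    ext v i
    simp [parityTransvection_apply]
  map_mul' a c := by
    refine LinearMap.ext fun v => funext fun i => ?_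
    rw [Module.End.mul_apply, parityTransvection_apply, parityTransvection_apply,
      parityTransvection_apply]
    by_cases h : i.val.bodd = b
    · rw [if_pos h, if_pos h, if_pos h, coordShift_parityTransvection b _ v i h, toAdd_mul]
      ring
    · rw [if_neg h, if_neg h, if_neg h, add_zero, add_zero]

/-- The subgroup of parity transvections. -/
def paritySubgroup (F : Type*) [Field F] (D : ℕ) (b : Bool) :
    Subgroup (Module.End F (Fin (D + 1) → F))ˣ :=
  (parityTransvectionHom F D b).toHomUnits.range

/-- The group generated by the parity transvections. -/
def parityGroup (F : Type*) [Field F] (D : ℕ) : Subgroup (Module.End F (Fin (D + 1) → F))ˣ :=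
  paritySubgroup F D false ⊔ paritySubgroup F D true

theorem paritySubgroup_le (b : Bool) : paritySubgroup F D b ≤ parityGroup F D := by
  cases b
  · exact le_sup_left
  · exact le_sup_right

theorem mem_paritySubgroup {b : Bool} {s : (Module.End F (Fin (D + 1) → F))ˣ} :
    s ∈ paritySubgroup F D b ↔ ∃ a, parityTransvection D b a = s.val :=
  ⟨fun ⟨a, ha⟩ => ⟨a.toAdd, congrArg Units.val ha⟩, fun ⟨a, ha⟩ => ⟨.ofAdd a, Units.ext ha⟩⟩

theorem exists_parityTransvection_single (hD : 2 ≤ D) (b : Bool) :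
    ∃ (v : Fin (D + 1) → F) (i : Fin (D + 1)), i.val.bodd = b ∧
      ∀ a, parityTransvection D b a v i = v i + a := by
  obtain ⟨k, hk, hkb⟩ : ∃ k, k < 2 ∧ (k + 1).bodd = b := by
    cases b
    · exact ⟨1, by omega, rfl⟩
    · exact ⟨0, by omega, rfl⟩
  refine ⟨Pi.single ⟨k, by omega⟩ 1, ⟨k + 1, by omega⟩, hkb, fun a => ?_⟩
  rw [parityTransvection_apply, if_pos hkb, coordShift_apply]
  simp

theorem card_paritySubgroup (hD : 2 ≤ D) (b : Bool) :
    Nat.card (paritySubgroup F D b) = Nat.card F := by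
  have hinj : Function.Injective (parityTransvectionHom F D b).toHomUnits := by
    intro a c h
    obtain ⟨v, i, -, h1⟩ := exists_parityTransvection_single (F := F) hD b
    have h2 : parityTransvection D b a.toAdd v i = parityTransvection D b c.toAdd v i :=
      congrFun (LinearMap.congr_fun (congrArg Units.val h) v) i
    rw [h1, h1] at h2
    exact Multiplicative.toAdd.injective (add_left_cancel h2)
  exact (Nat.card_congr (MonoidHom.ofInjective hinj).toEquiv).symm

theorem paritySubgroup_inf_eq_bot (hD : 2 ≤ D) (b : Bool) :
    paritySubgroup F D b ⊓ paritySubgroup F D (!b) = ⊥ := by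
  refine (Subgroup.eq_bot_iff_forall _).2 fun s ⟨h, h'⟩ => ?_
  obtain ⟨a, ha⟩ := mem_paritySubgroup.1 h
  obtain ⟨c, hc⟩ := mem_paritySubgroup.1 h'
  obtain ⟨v, i, hi, h1⟩ := exists_parityTransvection_single (F := F) hD b
  have h2 := h1 a
  rw [ha, ← hc, parityTransvection_apply, if_neg (by rw [hi]; cases b <;> simp),
    add_left_cancel_iff] at h2
  subst h2
  exact Units.ext (ha.symm.trans (parityTransvectionHom F D b).map_one)

theorem parityGroup_apply_zero {γ : (Module.End F (Fin (D + 1) → F))ˣ} (hγ : γ ∈ parityGroup F D)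
    (v : Fin (D + 1) → F) : γ.val v 0 = v 0 := by
  let S : Subgroup (Module.End F (Fin (D + 1) → F))ˣ :=
    { carrier := {γ | ∀ v, γ.val v 0 = v 0}
      one_mem' := fun v => rfl
      mul_mem' := fun {γ δ} h h' v => (h _).trans (h' v)
      inv_mem' := fun {γ} h v => by
        rw [← h (γ⁻¹.val v), ← Module.End.mul_apply, Units.mul_inv, Module.End.one_apply] }
  have hS : ∀ b, paritySubgroup F D b ≤ S := by
    intro b s hs v
    obtain ⟨a, ha⟩ := mem_paritySubgroup.1 hs
    rw [← ha, parityTransvection_apply, coordShift_apply]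
    simp
  exact sup_le (hS false) (hS true) hγ v

theorem parityGroup_commute {γ : (Module.End F (Fin (D + 1) → F))ˣ} (hγ : γ ∈ parityGroup F D) :
    Commute γ.val (coordShift F D * coordShift F D) := by
  let S : Subgroup (Module.End F (Fin (D + 1) → F))ˣ :=
    { carrier := {γ | Commute γ.val (coordShift F D * coordShift F D)}
      one_mem' := Commute.one_left _
      mul_mem' := fun {γ δ} h h' => Commute.mul_left h h'
      inv_mem' := fun {γ} h => Commute.units_inv_left h }
  have hS : ∀ b, paritySubgroup F D b ≤ S := by
    intro b s hs
    obtain ⟨a, ha⟩ := mem_paritySubgroup.1 hs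
    refine LinearMap.ext fun v => funext fun i => ?_
    rw [← ha]
    obtain ⟨i, hi⟩ := i
    rcases i with _ | _ | i
    · simp [Module.End.mul_apply, parityTransvection_apply, coordShift_apply]
    · simp [Module.End.mul_apply, parityTransvection_apply, coordShift_apply]
    · simp [Module.End.mul_apply, parityTransvection_apply, coordShift_apply]
  exact sup_le (hS false) (hS true) hγ

theorem card_parityGroup_le [Finite F] (hD : 2 ≤ D) :
    Nat.card (parityGroup F D) ≤ Nat.card F ^ (2 * D) := by
  let e (k : ℕ) (hk : k < D + 1) : Fin (D + 1) → F := Pi.single ⟨k, hk⟩ 1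
  let f (γ : parityGroup F D) (k : Fin D) : F × F :=
    (γ.val.val (e 0 (by omega)) k.succ, γ.val.val (e 1 (by omega)) k.succ)
  have hshift : ∀ k (hk : k + 2 < D + 1), e (k + 2) hk =
      (coordShift F D * coordShift F D) (e k (by omega)) := by
    intro k hk
    ext ⟨i, hi⟩
    rcases i with _ | _ | i
    · simp [e, Module.End.mul_apply, coordShift_apply]
    · simp [e, Module.End.mul_apply, coordShift_apply]
    · simp [e, Module.End.mul_apply, coordShift_apply, Pi.single_apply]
  have hf : Function.Injective f := by
    intro γ δ h
    have hbase : ∀ k (hk : k < 2), γ.val.val (e k (by omega)) = δ.val.val (e k (by omega)) := by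
      intro k hk
      ext i
      cases i using Fin.cases with
      | zero => rw [parityGroup_apply_zero γ.2, parityGroup_apply_zero δ.2]
      | succ i =>
        interval_cases k
        · exact congrArg Prod.fst (congrFun h i)
        · exact congrArg Prod.snd (congrFun h i)
    have hall : ∀ k (hk : k < D + 1), γ.val.val (e k hk) = δ.val.val (e k hk) := by
      intro k
      induction k using Nat.strong_induction_on with
      | _ k ih =>
      intro hk
      rcases lt_or_ge k 2 with h2 | h2
      · exact hbase k h2
      · obtain ⟨k, rfl⟩ := Nat.exists_eq_add_of_le' h2
        rw [hshift, ← Module.End.mul_apply, ← Module.End.mul_apply,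
          (parityGroup_commute γ.2).eq, (parityGroup_commute δ.2).eq, Module.End.mul_apply,
          Module.End.mul_apply (_ * _), ih k (by omega)]
    refine Subtype.ext (Units.ext ((Pi.basisFun F _).ext fun i => ?_))
    rw [Pi.basisFun_apply]
    exact hall i i.2
  refine (Nat.card_le_card_of_injective f hf).trans_eq ?_
  rw [Nat.card_fun, Nat.card_prod, Nat.card_fin, ← sq, pow_mul]

/-- Vectors supported on the first `j` coordinates are mapped to vectors supported on the first
`j + n` coordinates. -/
def IsBanded (n : ℕ) (f : Module.End F (Fin (D + 1) → F)) : Prop :=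
  ∀ v j, (∀ i : Fin (D + 1), j < i.val → v i = 0) → ∀ i : Fin (D + 1), j + n < i.val → f v i = 0

theorem IsBanded.mul {m n : ℕ} {f g : Module.End F (Fin (D + 1) → F)} (hf : IsBanded m f)
    (hg : IsBanded n g) : IsBanded (m + n) (f * g) := fun v j hv i hi =>
  hf (g v) (j + n) (hg v j hv) i (by omega)

theorem isBanded_one_parityTransvection (b : Bool) (a : F) :
    IsBanded 1 (parityTransvection D b a) := by
  intro v j hv i hi
  rw [parityTransvection_apply, coordShift_apply, hv i (by omega), hv ⟨i - 1, _⟩ (by simp; omega)]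
  simp

/-- The subgroups whose coset graph has large girth and connectivity. -/
abbrev paritySubgroupOf (F : Type*) [Field F] (D : ℕ) (b : Bool) : Subgroup (parityGroup F D) :=
  (paritySubgroup F D b).subgroupOf (parityGroup F D)

theorem IsAltProd.isBanded {b : Bool} {n : ℕ} {γ : parityGroup F D}
    (h : IsAltProd (paritySubgroupOf F D) b n γ) :
    IsBanded n γ.val.val ∧ IsBanded n γ⁻¹.val.val := by
  induction h with
  | one b => exact ⟨fun v j hv i hi => hv i hi, fun v j hv i hi => hv i hi⟩
  | @mul b n s γ hs _ _ ih =>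
    have key : ∀ {t : parityGroup F D}, t ∈ paritySubgroupOf F D b → IsBanded 1 t.val.val := by
      intro t ht
      obtain ⟨a, ha⟩ := mem_paritySubgroup.1 (Subgroup.mem_subgroupOf.1 ht)
      exact ha ▸ isBanded_one_parityTransvection b a
    refine ⟨add_comm 1 n ▸ (key hs).mul ih.1, ?_⟩
    rw [mul_inv_rev]
    exact ih.2.mul (key (inv_mem hs))

theorem IsAltProd.apply_ne_zero {b : Bool} {n : ℕ} {γ : parityGroup F D}
    (h : IsAltProd (paritySubgroupOf F D) b n γ) {v : Fin (D + 1) → F} {j : ℕ}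
    (hj : j + n < D + 1) (hb : (j + n).bodd = b) (hv : ∀ i : Fin (D + 1), j < i.val → v i = 0)
    (hvj : v ⟨j, by omega⟩ ≠ 0) : γ.val.val v ⟨j + n, hj⟩ ≠ 0 := by
  induction h with
  | one b => exact hvj
  | @mul b n s γ hs hs1 h ih =>
    obtain ⟨a, ha⟩ := mem_paritySubgroup.1 (Subgroup.mem_subgroupOf.1 hs)
    have ha0 : a ≠ 0 := by
      rintro rfl
      exact hs1 (Subtype.ext (Units.ext (ha.symm.trans (parityTransvectionHom F D b).map_one)))
    have h1 := ih (by omega) (by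
      rw [← hb, ← add_assoc, Nat.bodd_succ, Bool.not_not])
    change s.val.val (γ.val.val v) _ ≠ 0
    rw [← ha, parityTransvection_apply, if_pos hb, coordShift_apply,
      h.isBanded.1 v j hv _ (by simp), zero_add, if_pos (by simp)]
    exact mul_ne_zero ha0 (h1 hvj)

theorem IsAltProd.notMem_of_bodd {b : Bool} {n : ℕ} {γ : parityGroup F D}
    (h : IsAltProd (paritySubgroupOf F D) b n γ) (hn : n.bodd) (hD : n + 1 ≤ 2 * (D - 1)) :
    γ ∉ paritySubgroupOf F D (!b) := by
  intro hγ
  obtain ⟨k, rfl⟩ : ∃ k, n = k + 1 + k := by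
    refine ⟨n.div2, ?_⟩
    have := Nat.bodd_add_div2 n
    rw [hn] at this
    simp at this
    omega
  obtain ⟨c, δ, ε, hδ, hε, rfl⟩ := h.exists_mul_eq
  obtain ⟨a, ha⟩ := mem_paritySubgroup.1 (Subgroup.mem_subgroupOf.1 hγ)
  obtain ⟨j, hj, hjb⟩ : ∃ j, j < 2 ∧ (j + (k + 1)).bodd = b := by
    by_cases hb : (0 + (k + 1)).bodd = b
    · exact ⟨0, by omega, hb⟩
    · refine ⟨1, by omega, ?_⟩
      rw [add_comm, Nat.bodd_succ]
      rw [zero_add] at hb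
      revert hb
      cases b <;> simp
  have hjD : j + (k + 1) < D + 1 := by omega
  let v : Fin (D + 1) → F := Pi.single ⟨j, by omega⟩ 1
  have hv : ∀ i : Fin (D + 1), j < i.val → v i = 0 := fun i hi =>
    Pi.single_eq_of_ne (fun h => by rw [h] at hi; exact hi.false) _
  refine hδ.apply_ne_zero hjD hjb hv (by simp [v]) ?_
  have h1 : δ.val.val v = (δ * ε).val.val (ε⁻¹.val.val v) := by
    rw [← Module.End.mul_apply, ← Units.val_mul, ← Subgroup.coe_mul, mul_inv_cancel_right]
  rw [h1, ← ha, parityTransvection_apply, if_neg (by rw [hjb]; cases b <;> simp), add_zero]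
  exact hε.isBanded.2 v j hv _ (by simp)

end ShiftGroup

open scoped Classical in
theorem exists_boundaryConnected_le_egirth (F : Type*) [Field F] [Finite F] (g : ℕ) (hg : 3 ≤ g) :
    ∃ m, m ≤ 2 * Nat.card F ^ (g + 1) ∧ Nat.card F ≤ m ∧ ∃ G : SimpleGraph (Fin m),
      BoundaryConnected G (Nat.card F) ∧ (g : ℕ∞) ≤ G.egirth := by
  obtain ⟨D, hD⟩ : ∃ D, D = (g - 1) / 2 + 1 := ⟨_, rfl⟩
  have hD2 : 2 ≤ D := by omega
  have hinj : Function.Injective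
      fun (f : Module.End F (Fin (D + 1) → F)) v => f v := DFunLike.coe_injective
  have : Finite (Module.End F (Fin (D + 1) → F)) := Finite.of_injective _ hinj
  have : Finite (Module.End F (Fin (D + 1) → F))ˣ := Finite.of_injective _ Units.val_injective
  let K := paritySubgroupOf F D
  have := Fintype.ofFinite (Σ b, parityGroup F D ⧸ K b)
  have hcard : ∀ b, Nat.card (K b) = Nat.card F := fun b =>
    (Nat.card_congr (Subgroup.subgroupOfEquivOfLe (paritySubgroup_le b)).toEquiv).trans
      (card_paritySubgroup hD2 b)
  have htop : K false ⊔ K true = ⊤ := by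
    rw [← Subgroup.subgroupOf_sup (paritySubgroup_le false) (paritySubgroup_le true)]
    exact Subgroup.subgroupOf_self _
  have hbot : ∀ b, K b ⊓ K (!b) = ⊥ := fun b => by
    change Subgroup.subgroupOf _ _ ⊓ Subgroup.subgroupOf _ _ = _
    rw [Subgroup.subgroupOf, Subgroup.subgroupOf, ← Subgroup.comap_inf,
      paritySubgroup_inf_eq_bot hD2]
    exact Subgroup.bot_subgroupOf _
  have hbc := boundaryConnected_cosetGraph htop hbot fun b => (hcard b).ge
  have hgirth : (g : ℕ∞) ≤ (cosetGraph K).egirth :=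
    le_egirth_cosetGraph fun b n γ h hn hlt => h.notMem_of_bodd hn (by
      have h2 := Nat.bodd_add_div2 n
      rw [hn, Bool.toNat_true] at h2
      omega)
  let e := Fintype.equivFin (Σ b, parityGroup F D ⧸ K b)
  let f := Iso.map e (cosetGraph K)
  refine ⟨_, ?_, ?_, (cosetGraph K).map e, hbc.map_iso f, ?_⟩
  · rw [← Nat.card_eq_fintype_card]
    refine card_cosetGraph_le.trans (Nat.mul_le_mul_left 2 ((card_parityGroup_le hD2).trans ?_))
    exact Nat.pow_le_pow_right Nat.card_pos (by omega)
  · rw [← hcard false]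
    exact (card_le_card_outerBoundary_cosetGraph hbot false 1).trans (card_le_univ _)
  · rwa [← f.egirth_eq]

theorem pebblingNumber_top_fin_three : pebblingNumber (⊤ : SimpleGraph (Fin 3)) = 3 := by
  refine pebblingNumber_eq_card fun r C hC => ?_
  by_cases hr : C r = 0
  · obtain ⟨v, hv⟩ : ∃ v, 2 ≤ C v := by
      by_contra! h
      have h1 := sum_erase_add univ C (mem_univ r)
      have h2 : ∑ v ∈ univ.erase r, C v ≤ _ := sum_le_card_nsmul (univ.erase r) C 1 fun v _ => Nat.le_of_lt_succ (h v)
      rw [card_erase_of_mem (mem_univ r), card_univ, Fintype.card_fin, smul_eq_mul] at h2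
      rw [hC, Fintype.card_fin] at h1
      omega
    have hvr : v ≠ r := by
      rintro rfl
      omega
    exact reaches_of_pow_le (Adj.toWalk (G := ⊤) hvr) le_rfl hv
  · exact ⟨C, .refl, Nat.one_le_iff_ne_zero.2 hr⟩

theorem exists_class0_le_girth {g n : ℕ} (hn : 3 ≤ n) (hg : 4 ≤ g → 2 ^ (2 * g ^ 2 + 2 * g) ≤ n) :
    ∃ m ≤ n, ∃ G : SimpleGraph (Fin m), G.Connected ∧
      pebblingNumber G = Fintype.card (Fin m) ∧ ¬ G.IsAcyclic ∧ g ≤ G.girth := by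
  rcases lt_or_ge g 4 with h | h
  · have h3 : (⊤ : SimpleGraph (Fin 3)).girth = 3 := girth_top (by simp)
    refine ⟨3, hn, ⊤, connected_top, pebblingNumber_top_fin_three, fun hac => ?_, by omega⟩
    rw [hac.girth_eq_zero] at h3
    omega
  · have hcard : Nat.card (GaloisField 2 (2 * g - 1)) = 2 ^ (2 * g - 1) :=
      GaloisField.card 2 _ (by omega)
    obtain ⟨m, hmn, hm, G, hG, hgG⟩ :=
      exists_boundaryConnected_le_egirth (GaloisField 2 (2 * g - 1)) g (by omega)
    rw [hcard] at hmn hm hG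
    refine ⟨m, hmn.trans (le_trans ?_ (hg h)), exists_class0_of_boundaryConnected h hgG hG ?_⟩
    · rw [← pow_mul, ← pow_succ']
      refine Nat.pow_le_pow_right two_pos ?_
      obtain ⟨j, rfl⟩ := Nat.exists_eq_add_of_le' h
      rw [show 2 * (j + 4) - 1 = 2 * j + 7 by omega]
      ring_nf
      omega
    · rw [Fintype.card_fin]
      exact le_trans (le_trans (by norm_num) (Nat.pow_le_pow_right two_pos
        (by omega : 2 ≤ 2 * g - 1))) hm

theorem two_pow_le_of_le_floor {g n : ℕ} (hn : 0 < n) (hg : 0 < g)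
    (h : g ≤ ⌊Real.sqrt (Real.logb 2 n / 2 + 1 / 4) - 1 / 2⌋₊) : 2 ^ (2 * g ^ 2 + 2 * g) ≤ n := by
  have h1 := (Nat.le_floor_iff' hg.ne').1 h
  have h2 : ((g : ℝ) + 1 / 2) ^ 2 ≤ Real.logb 2 n / 2 + 1 / 4 :=
    (Real.le_sqrt' (by positivity)).1 (by linarith)
  have h3 : ((2 * g ^ 2 + 2 * g : ℕ) : ℝ) ≤ Real.logb 2 n := by
    push_cast
    linarith
  rw [Real.le_logb_iff_rpow_le one_lt_two (by exact_mod_cast hn), Real.rpow_natCast] at h3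
  exact_mod_cast h3

/-- for all `n ≥ 3`,
`⌊√((lg n)/2 + 1/4) − 1/2⌋ ≤ g₀(n) ≤ 1 + 2·lg n`. -/
theorem girthClass0_bounds (n : ℕ) (hn : 3 ≤ n) :
    ⌊Real.sqrt (Real.logb 2 n / 2 + 1 / 4) - 1 / 2⌋₊ ≤ girthClass0 n ∧
      (girthClass0 n : ℝ) ≤ 1 + 2 * Real.logb 2 n :=
  ⟨le_csSup ⟨_, mem_upperBounds_girthClass0 n⟩ (exists_class0_le_girth hn fun h =>
    two_pow_le_of_le_floor (by omega) (by omega) le_rfl), girthClass0_le n⟩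
end

section
/- (Czygrinow–Hurlbert) Let B(m,k) denote the family of all connected bipartite simple graphs with m vertices in each part of the bipartition (so n = 2m vertices) and minimum degree at least k, and let b(m) be the smallest k such that every graph in B(m,k) is Class 0. Then b(m) ≥ ⌊m/2⌋ + 1 for all m ≥ 7, and b(m) = ⌊m/2⌋ + 1 for all m ≥ 336. -/
open SimpleGraph Finset

variable {V : Type*}

/-- `bipartiteClass0Bound m`: the least `k` such that every connected bipartite graph
with parts of size `m` and minimum degree at least `k` is Class 0. -/
noncomputable def bipartiteClass0Bound (m : ℕ) : ℕ :=
  sInf {k : ℕ | ∀ G : SimpleGraph (Fin m ⊕ Fin m), G.Connected →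
    (∀ u v, ¬ G.Adj (Sum.inl u) (Sum.inl v)) →
    (∀ u v, ¬ G.Adj (Sum.inr u) (Sum.inr v)) →
    (∀ v, k ≤ (G.neighborSet v).ncard) →
    pebblingNumber G = Fintype.card (Fin m ⊕ Fin m)}

namespace Pebbling

section Moves

variable {G : SimpleGraph V} {C C' D : V → ℕ} {r u v w : V}

theorem pebStep_iff : PebStep G C C' ↔ ∃ u v, G.Adj u v ∧ 2 ≤ C u ∧
    C' u = C u - 2 ∧ C' v = C v + 1 ∧ ∀ x, x ≠ u → x ≠ v → C' x = C x := by
  classical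
  constructor
  · rintro ⟨u, v, huv, hu, rfl⟩
    refine ⟨u, v, huv, hu, ?_, ?_, fun x hxu hxv => ?_⟩
    · simp [huv.ne]
    · simp
    · simp [hxu, hxv]
  · rintro ⟨u, v, huv, hu, h1, h2, h3⟩
    refine ⟨u, v, huv, hu, ?_⟩
    ext x
    by_cases hxv : x = v
    · subst hxv; simp [h2]
    · by_cases hxu : x = u
      · subst hxu; simp [hxv, h1]
      · simp [hxu, hxv, h3 x hxu hxv]

theorem reaches_of_pos (h : 1 ≤ C r) : Reaches G C r := ⟨C, .refl, h⟩

theorem reaches_mono (h : Reaches G C r) (hle : C ≤ C') : Reaches G C' r := by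
  classical
  obtain ⟨E, hE, hr⟩ := h
  induction hE using Relation.ReflTransGen.head_induction_on generalizing C' with
  | refl => exact reaches_of_pos (hr.trans (hle r))
  | head hstep _ ih =>
    obtain ⟨u, v, huv, hu, rfl⟩ := hstep
    have hstep' : PebStep G C'
        (Function.update (Function.update C' u (C' u - 2)) v (C' v + 1)) := by
      refine ⟨u, v, huv, hu.trans (hle u), ?_⟩
      congr
    obtain ⟨E', hE', hr'⟩ := ih (C' := Function.update (Function.update C' u (C' u - 2)) v
      (C' v + 1)) (fun x => by
        simp only [Function.update_apply]
        split_ifs with h1 h2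
        · exact Nat.succ_le_succ (hle v)
        · exact Nat.sub_le_sub_right (hle u) 2
        · exact hle x)
    exact ⟨E', .head hstep' hE', hr'⟩

/-- A property preserved by pebbling steps and excluding a pebble on the root
certifies that the root is not reached. -/
theorem not_reaches_of_invariant (P : (V → ℕ) → Prop)
    (hstep : ∀ C C', P C → PebStep G C C' → P C') (hr : ∀ C, P C → C r = 0) (hC : P C) :
    ¬ Reaches G C r := by
  rintro ⟨E, hE, hpos⟩
  have hP : ∀ E, Relation.ReflTransGen (PebStep G) C E → P E := by
    intro E hE
    induction hE with
    | refl => exact hC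
    | tail _ h ih => exact hstep _ _ ih h
  have := hr E (hP E hE)
  omega

theorem not_reaches_of_le_one (h : ∀ v, C v ≤ 1) (hr : C r = 0) : ¬ Reaches G C r := by
  refine not_reaches_of_invariant (fun C => (∀ v, C v ≤ 1) ∧ C r = 0) ?_ (fun _ h => h.2) ⟨h, hr⟩
  rintro C C' ⟨h, -⟩ ⟨u, v, -, hu, -⟩
  have := h u
  omega

/-- Three pebbles behind a cut vertex `x` and at most one pebble elsewhere do not reach a root
on the other side of `x`. -/
theorem not_reaches_of_cut {S : Set V} {x r : V} {C : V → ℕ} (hx : x ∉ S) (hr : r ∉ S)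
    (hxr : x ≠ r) (hS : ∀ u ∈ S, ∀ v, G.Adj u v → v ∈ S ∨ v = x) {a : V} (ha : a ∈ S)
    (hCa : C a ≤ 3) (hC : ∀ v, v ≠ a → C v ≤ 1) (hCx : C x = 0) (hCr : C r = 0) :
    ¬ Reaches G C r := by
  refine not_reaches_of_invariant (fun C => C r = 0 ∧ ((∀ v, C v ≤ 1) ∨
    (C x = 0 ∧ ∃ a ∈ S, C a ≤ 3 ∧ ∀ v, v ≠ a → C v ≤ 1))) ?_ (fun _ h => h.1)
    ⟨hCr, .inr ⟨hCx, a, ha, hCa, hC⟩⟩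
  rintro C C' ⟨hCr, h⟩ hstep
  obtain ⟨u, v, huv, hu, h1, h2, h3⟩ := pebStep_iff.1 hstep
  rcases h with h | ⟨hCx, a, ha, hCa, hC⟩
  · have := h u
    omega
  obtain rfl : u = a := by
    by_contra hua
    have := hC u hua
    omega
  have hv := hS u ha v huv
  have hur : r ≠ u := by rintro rfl; exact hr ha
  have hvr : r ≠ v := by rintro rfl; exact hv.elim hr (fun h => hxr h.symm)
  refine ⟨(h3 r hur hvr).trans hCr, ?_⟩
  rcases hv with hv | rfl
  · refine .inr ⟨(h3 x (by rintro rfl; exact hx ha) (by rintro rfl; exact hx hv)).trans hCx,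
      v, hv, ?_, fun y hy => ?_⟩
    · have := hC v huv.ne'
      omega
    · by_cases hyu : y = u
      · subst hyu; omega
      · rw [h3 y hyu hy]
        exact hC y hyu
  · refine .inl fun y => ?_
    by_cases hyv : y = v
    · subst hyv; omega
    · by_cases hyu : y = u
      · subst hyu; omega
      · rw [h3 y hyu hyv]
        exact hC y hyu

variable [DecidableEq V]

theorem reaches_of_move (huv : G.Adj u v) (hD : Reaches G (D + Pi.single v 1) r) :
    Reaches G (D + Pi.single u 2) r := by
  obtain ⟨E, hE, hr⟩ := hD
  refine ⟨E, .head (pebStep_iff.2 ⟨u, v, huv, ?_, ?_, ?_, fun x hxu hxv => ?_⟩) hE, hr⟩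
  · simp
  · simp [huv.ne]
  · simp [huv.ne']
  · simp [hxu, hxv]

/-- Every vertex of `T` sends one pebble to the common neighbor `v`. -/
theorem reaches_of_gather {T : Finset V} (hT : ∀ u ∈ T, G.Adj u v)
    (hD : Reaches G (D + Pi.single v #T) r) :
    Reaches G (D + ∑ u ∈ T, Pi.single u 2) r := by
  induction T using Finset.induction_on generalizing D with
  | empty => simpa using hD
  | insert a T ha ih =>
    rw [sum_insert ha, add_comm (Pi.single a 2), ← add_assoc]
    refine reaches_of_move (hT a (mem_insert_self a T)) ?_
    rw [add_right_comm]
    refine ih (fun u hu => hT u (mem_insert_of_mem hu)) ?_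
    rw [card_insert_of_notMem ha, add_comm #T 1, Pi.single_add, ← add_assoc] at hD
    exact hD

theorem reaches_of_two_le (hvr : G.Adj v r) (hv : 2 ≤ C v) : Reaches G C r := by
  refine reaches_mono (reaches_of_move (D := 0) hvr (reaches_of_pos (by simp))) fun x => ?_
  simp only [Pi.add_apply, Pi.single_apply, Pi.zero_apply]
  split_ifs with h
  · subst h; omega
  · omega

theorem reaches_of_two_mul_le {a : ℕ} (huv : G.Adj u v)
    (hv : ∀ C : V → ℕ, a ≤ C v → Reaches G C r) (hu : 2 * a ≤ C u) : Reaches G C r := by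
  have key : ∀ (b : ℕ) (D : V → ℕ), Reaches G (D + Pi.single v b) r →
      Reaches G (D + Pi.single u (2 * b)) r := by
    intro b
    induction b with
    | zero => intro D h; simpa using h
    | succ b ih =>
      intro D h
      rw [mul_add, mul_one, Pi.single_add, ← add_assoc]
      refine reaches_of_move huv ?_
      rw [add_right_comm]
      refine ih _ ?_
      rwa [add_assoc, ← Pi.single_add, add_comm 1 b]
  refine reaches_mono (key a 0 (hv _ (by simp))) fun x => ?_
  simp only [Pi.add_apply, Pi.single_apply, Pi.zero_apply]
  split_ifs with h
  · subst h; omega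
  · omega

theorem sum_single_two_le {T : Finset V} (hT : ∀ u ∈ T, 2 ≤ C u) :
    ∑ u ∈ T, Pi.single u 2 ≤ C := by
  intro x
  rw [Finset.sum_apply, Finset.sum_pi_single]
  split_ifs with h
  · exact hT x h
  · exact Nat.zero_le _

/-- As far as reaching `r` is concerned, the pebbles of `e` are worth at least two pebbles
on `w`. -/
def Supplies (G : SimpleGraph V) (r : V) (e : V → ℕ) (w : V) : Prop :=
  ∀ D : V → ℕ, Reaches G (D + Pi.single w 2) r → Reaches G (D + e) r

theorem supplies_self : Supplies G r (Pi.single w 2) w := fun _ h => h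

theorem supplies_of_adj (h : G.Adj u w) : Supplies G r (Pi.single u 2 + Pi.single w 1) w := by
  intro D hD
  rw [add_comm (Pi.single u 2), ← add_assoc]
  refine reaches_of_move h ?_
  rwa [add_assoc, ← Pi.single_add]

theorem reaches_of_supplies {e : V → ℕ} {t : V} (he : Supplies G r e w) (hwu : G.Adj w u)
    (hut : G.Adj u t) (htr : G.Adj t r) :
    Reaches G (Pi.single u 1 + Pi.single t 1 + e) r := by
  refine he _ (reaches_of_move hwu ?_)
  rw [add_right_comm, ← Pi.single_add, add_comm]
  refine reaches_of_move hut ?_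
  rw [← Pi.single_add]
  exact reaches_of_two_le htr (by simp)

theorem reaches_of_supplies_two {e₁ e₂ : V → ℕ} {w₁ w₂ u₁ u₂ t : V}
    (h₁ : Supplies G r e₁ w₁) (h₂ : Supplies G r e₂ w₂) (hwu₁ : G.Adj w₁ u₁)
    (hwu₂ : G.Adj w₂ u₂) (hut₁ : G.Adj u₁ t) (hut₂ : G.Adj u₂ t) (htr : G.Adj t r) :
    Reaches G (Pi.single u₁ 1 + Pi.single u₂ 1 + e₁ + e₂) r := by
  refine h₂ _ (reaches_of_move hwu₂ ?_)
  rw [add_right_comm]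
  refine h₁ _ (reaches_of_move hwu₁ ?_)
  have : (Pi.single u₁ 1 + Pi.single u₂ 1 + Pi.single u₂ 1 + Pi.single u₁ 1 : V → ℕ) =
      Pi.single u₁ 2 + Pi.single u₂ 2 := by
    rw [show (2 : ℕ) = 1 + 1 from rfl, Pi.single_add, Pi.single_add]
    abel
  rw [this]
  refine reaches_of_move hut₂ ?_
  rw [add_comm]
  refine reaches_of_move hut₁ ?_
  rw [← Pi.single_add]
  exact reaches_of_two_le htr (by simp)

end Moves

section Counting

variable [Fintype V] {G : SimpleGraph V} [DecidableRel G.Adj] {c : V → Bool} {m k : ℕ}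

theorem exists_many_adj (hc : ∀ u v, G.Adj u v → c u ≠ c v) (hm : ∀ b, #{v | c v = b} = m)
    (hk : ∀ v, k ≤ #{w | G.Adj v w}) (hmk : m < 2 * k) {b : Bool} {T : Finset V}
    (hT : ∀ v ∈ T, c v = b) (hne : T.Nonempty) :
    ∃ x, c x ≠ b ∧ #T < 2 * #{v ∈ T | G.Adj x v} := by
  by_contra! hcon
  have h1 : ∑ v ∈ T, #{x | G.Adj v x} = ∑ x with c x = !b, #{v ∈ T | G.Adj x v} := by
    simp only [card_filter]
    rw [sum_comm, sum_filter]
    refine sum_congr rfl fun x _ => ?_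
    split_ifs with hx
    · exact sum_congr rfl fun v _ => by simp only [G.adj_comm]
    · refine sum_eq_zero fun v hv => ?_
      rw [if_neg]
      intro hvx
      have h2 := hc v x hvx
      rw [hT v hv] at h2
      cases b <;> simp_all
  have h2 : #T * k ≤ ∑ v ∈ T, #{x | G.Adj v x} := by
    simpa using card_nsmul_le_sum T _ k fun v _ => hk v
  have h3 : ∑ x with c x = !b, 2 * #{v ∈ T | G.Adj x v} ≤ m * #T := by
    rw [← hm (!b), ← smul_eq_mul]
    refine sum_le_card_nsmul _ _ _ fun x hx => hcon x ?_
    have := (mem_filter.1 hx).2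
    cases b <;> simp_all
  rw [← mul_sum, ← h1] at h3
  have h4 : 0 < #T := hne.card_pos
  nlinarith

theorem exists_common_adj (hc : ∀ u v, G.Adj u v → c u ≠ c v) (hm : ∀ b, #{v | c v = b} = m)
    (hk : ∀ v, k ≤ #{w | G.Adj v w}) (hmk : m < 2 * k) {u v : V} (huv : c u = c v) :
    ∃ x, G.Adj x u ∧ G.Adj x v := by
  classical
  obtain ⟨x, -, hx⟩ := exists_many_adj hc hm hk hmk (b := c v) (T := {u, v})
    (by simp [huv]) (by simp)
  have h : ({u, v} : Finset V).filter (fun y => G.Adj x y) = {u, v} := by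
    refine eq_of_subset_of_card_le (filter_subset _ _) ?_
    have := card_le_two (a := u) (b := v)
    have : 0 < #({u, v} : Finset V) := by simp
    omega
  rw [filter_eq_self] at h
  exact ⟨x, h u (by simp), h v (by simp)⟩

end Counting

section Unsolvable

variable [Fintype V] [DecidableEq V] {G : SimpleGraph V} [DecidableRel G.Adj] {c : V → Bool}
  {m k : ℕ} {C : V → ℕ} {r : V}

theorem card_near_le (hc : ∀ u v, G.Adj u v → c u ≠ c v) (hm : ∀ b, #{v | c v = b} = m)
    (hk : ∀ v, k ≤ #{w | G.Adj v w}) (hmk : m < 2 * k) (hR : ¬ Reaches G C r) :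
    #{v | c v = c r ∧ 2 ≤ C v} ≤ 8 := by
  by_contra! hcard
  obtain ⟨x, hx, hlt⟩ := exists_many_adj hc hm hk hmk (b := c r)
    (T := {v | c v = c r ∧ 2 ≤ C v}) (fun v hv => (mem_filter.1 hv).2.1) (card_pos.1 (by omega))
  set T : Finset V := {v ∈ ({v | c v = c r ∧ 2 ≤ C v} : Finset V) | G.Adj x v} with hTdef
  have hT : ∀ v ∈ T, G.Adj v x ∧ 2 ≤ C v ∧ c v = c r := by
    intro v hv
    simp only [hTdef, mem_filter, mem_univ, true_and] at hv
    exact ⟨hv.2.symm, hv.1.2, hv.1.1⟩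
  obtain ⟨u, hu⟩ : T.Nonempty := card_pos.1 (by omega)
  obtain ⟨S, hS, hS4⟩ := exists_subset_card_eq (s := T.erase u) (n := 4)
    (by rw [card_erase_of_mem hu]; omega)
  have hST : ∀ v ∈ S, v ∈ T := fun v hv => mem_of_mem_erase (hS hv)
  have huS : u ∉ S := fun h => notMem_erase u T (hS h)
  by_cases hxr : G.Adj x r
  · refine hR (reaches_mono (reaches_of_gather (D := 0) (fun v hv => (hT v (hST v hv)).1) ?_)
      ((zero_add _).trans_le (sum_single_two_le fun v hv => (hT v (hST v hv)).2.1)))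
    exact reaches_of_two_le hxr (by simp [hS4])
  · obtain ⟨t, htu, htr⟩ := exists_common_adj hc hm hk hmk (hT u hu).2.2
    refine hR (reaches_mono (reaches_of_gather (D := Pi.single u 2) (T := S)
      (fun v hv => (hT v (hST v hv)).1) ?_) ?_)
    · rw [hS4, show (4 : ℕ) = 2 + 2 from rfl, Pi.single_add, ← add_assoc]
      refine reaches_of_move (hT u hu).1.symm ?_
      rw [add_right_comm]
      refine reaches_of_move (hT u hu).1.symm ?_
      exact reaches_of_two_mul_le htu.symm (fun _ => reaches_of_two_le htr) (by simp)
    · rw [← sum_insert (f := fun u => (Pi.single u 2 : V → ℕ)) huS]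
      refine sum_single_two_le fun v hv => ?_
      rcases mem_insert.1 hv with rfl | hv
      · exact (hT v hu).2.1
      · exact (hT v (hST v hv)).2.1

theorem card_far_le (hc : ∀ u v, G.Adj u v → c u ≠ c v) (hm : ∀ b, #{v | c v = b} = m)
    (hk : ∀ v, k ≤ #{w | G.Adj v w}) (hmk : m < 2 * k) (hR : ¬ Reaches G C r) :
    #{v | c v ≠ c r ∧ 2 ≤ C v} ≤ 6 := by
  by_contra! hcard
  obtain ⟨x, hx, hlt⟩ := exists_many_adj hc hm hk hmk (b := !c r)
    (T := {v | c v ≠ c r ∧ 2 ≤ C v})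
    (by simp only [mem_filter]; rintro v ⟨-, h, -⟩; revert h; cases c v <;> cases c r <;> simp)
    (card_pos.1 (by omega))
  obtain ⟨S, hS, hS4⟩ := exists_subset_card_eq (n := 4)
    (s := {v ∈ ({v | c v ≠ c r ∧ 2 ≤ C v} : Finset V) | G.Adj x v}) (by omega)
  have hxr : c x = c r := by revert hx; cases c x <;> cases c r <;> simp
  obtain ⟨t, htx, htr⟩ := exists_common_adj hc hm hk hmk hxr
  have hS' : ∀ v ∈ S, G.Adj v x ∧ 2 ≤ C v := by
    intro v hv
    have := hS hv
    simp only [mem_filter, mem_univ, true_and] at this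
    exact ⟨this.2.symm, this.1.2⟩
  refine hR (reaches_mono (reaches_of_gather (D := 0) (fun v hv => (hS' v hv).1) ?_)
    ((zero_add _).trans_le (sum_single_two_le fun v hv => (hS' v hv).2)))
  exact reaches_of_two_mul_le htx.symm (fun _ => reaches_of_two_le htr) (by simp [hS4])

theorem le_three_of_not_reaches (hc : ∀ u v, G.Adj u v → c u ≠ c v)
    (hm : ∀ b, #{v | c v = b} = m) (hk : ∀ v, k ≤ #{w | G.Adj v w}) (hmk : m < 2 * k)
    (hR : ¬ Reaches G C r) {v : V} (hv : c v = c r) : C v ≤ 3 := by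
  by_contra! h
  obtain ⟨t, htv, htr⟩ := exists_common_adj hc hm hk hmk hv
  exact hR (reaches_of_two_mul_le htv.symm (fun _ => reaches_of_two_le htr) h)

theorem le_seven_of_not_reaches (hc : ∀ u v, G.Adj u v → c u ≠ c v)
    (hm : ∀ b, #{v | c v = b} = m) (hk : ∀ v, k ≤ #{w | G.Adj v w}) (hmk : m < 2 * k)
    (hR : ¬ Reaches G C r) {v : V} (hv : c v ≠ c r) : C v ≤ 7 := by
  by_contra! h
  obtain ⟨u, hu⟩ : ({u | G.Adj v u} : Finset V).Nonempty :=
    card_pos.1 (lt_of_lt_of_le (by omega) (hk v))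
  have hvu : G.Adj v u := by simpa using hu
  have hur : c u = c r := by
    have := hc v u hvu
    revert hv this
    cases c u <;> cases c v <;> cases c r <;> simp
  obtain ⟨t, htu, htr⟩ := exists_common_adj hc hm hk hmk hur
  exact hR (reaches_of_two_mul_le (a := 4) hvu (fun _ h4 => reaches_of_two_mul_le htu.symm
    (fun _ => reaches_of_two_le htr) h4) h)

theorem card_zero_le (hc : ∀ u v, G.Adj u v → c u ≠ c v) (hm : ∀ b, #{v | c v = b} = m)
    (hk : ∀ v, k ≤ #{w | G.Adj v w}) (hmk : m < 2 * k) (hR : ¬ Reaches G C r)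
    (hC : ∑ v, C v = Fintype.card V) : #{v | C v = 0} ≤ 52 := by
  have key : ∑ v, (C v + if C v = 0 then 1 else 0) ≤
      ∑ v, (1 + 2 * (if c v = c r ∧ 2 ≤ C v then 1 else 0) +
        6 * (if c v ≠ c r ∧ 2 ≤ C v then 1 else 0)) := by
    refine sum_le_sum fun v _ => ?_
    by_cases hv : c v = c r
    · have := le_three_of_not_reaches hc hm hk hmk hR hv
      simp only [hv]
      split_ifs <;> simp_all
    · have := le_seven_of_not_reaches hc hm hk hmk hR hv
      simp only [hv]
      split_ifs <;> simp_all
  simp only [sum_add_distrib, ← mul_sum, ← card_filter, hC, sum_const, card_univ,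
    smul_eq_mul, mul_one] at key
  have h1 := card_near_le hc hm hk hmk hR
  have h2 := card_far_le hc hm hk hmk hR
  omega

/-- In an unsolvable configuration with few empty vertices, every vertex `x` with two pebbles
supplies a vertex `w` at distance three from the root, all of whose occupied neighbors are
adjacent only to empty neighbors of the root. -/
theorem exists_supplies (hc : ∀ u v, G.Adj u v → c u ≠ c v)
    (hk : ∀ v, k ≤ #{w | G.Adj v w}) (hR : ¬ Reaches G C r) {A : Finset V}
    (hA : #{v | C v = 0} + #A < k) {x : V} (hx : 2 ≤ C x) (hxA : x ∉ A) :
    ∃ e w, Supplies G r e w ∧ w ∉ A ∧ e ≤ C ∧ (∀ a, a ≠ x → a ≠ w → e a = 0) ∧ c w ≠ c r ∧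
      (c x ≠ c r → w = x) ∧ ¬ G.Adj w r ∧
      ∀ u t, G.Adj w u → C u ≠ 0 → G.Adj u t → G.Adj t r → C t = 0 := by
  have hr : C r = 0 := by
    by_contra h
    exact hR (reaches_of_pos (by omega))
  have hxr : ¬ G.Adj x r := fun h => hR (reaches_of_two_le h hx)
  by_cases hcx : c x = c r
  · have hxt : ∀ t, G.Adj x t → G.Adj t r → C t = 0 := by
      intro t hxt htr
      by_contra ht
      refine hR (reaches_mono (supplies_of_adj hxt 0 (reaches_of_two_le htr (by simp))) ?_)
      intro a
      have := hxt.ne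
      simp only [Pi.add_apply, Pi.single_apply, Pi.zero_apply]
      split_ifs <;> subst_vars <;> first | omega | contradiction
    obtain ⟨w, hw⟩ :
        (({w | G.Adj x w} : Finset V) \ (({v | C v = 0} : Finset V) ∪ A)).Nonempty := by
      rw [← card_pos]
      have h1 := le_card_sdiff (({v | C v = 0} : Finset V) ∪ A) ({w | G.Adj x w} : Finset V)
      have h2 := card_union_le ({v | C v = 0} : Finset V) A
      have h3 := hk x
      omega
    simp only [mem_sdiff, mem_filter, mem_univ, true_and, mem_union, not_or] at hw
    obtain ⟨hxw, hw0, hwA⟩ := hw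
    have hle : (Pi.single x 2 + Pi.single w 1 : V → ℕ) ≤ C := by
      intro a
      have := hxw.ne
      simp only [Pi.add_apply, Pi.single_apply]
      split_ifs <;> subst_vars <;> first | omega | contradiction
    refine ⟨_, w, supplies_of_adj hxw, hwA, hle, fun a h1 h2 => by simp [h1, h2],
      fun h => hc x w hxw (by rw [h, hcx]), fun h => absurd hcx h,
      fun h => hw0 (hxt w hxw h), fun u t hwu hu hut htr => ?_⟩
    by_contra ht
    have hux : u ≠ x := by rintro rfl; exact ht (hxt t hut htr)
    have htx : t ≠ x := by rintro rfl; exact hxr htr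
    have htw : t ≠ w := by rintro rfl; exact ht (hxt t hxw htr)
    refine hR (reaches_mono (reaches_of_supplies (supplies_of_adj hxw) hwu hut htr) fun a => ?_)
    have h1 := hle a
    have h2 := hut.ne
    have h3 := hwu.ne
    simp only [Pi.add_apply, Pi.single_apply] at h1 ⊢
    split_ifs at h1 ⊢ <;> subst_vars <;> first | omega | contradiction
  · refine ⟨_, x, supplies_self, hxA, ?_, fun a h1 _ => by simp [h1], hcx, fun _ => rfl, hxr,
      fun u t hxu hu hut htr => ?_⟩
    · intro a
      simp only [Pi.single_apply]
      split_ifs <;> subst_vars <;> omega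
    · by_contra ht
      have htx : t ≠ x := by rintro rfl; exact hxr htr
      refine hR (reaches_mono (reaches_of_supplies supplies_self hxu hut htr) fun a => ?_)
      have h2 := hut.ne
      have h3 := hxu.ne
      simp only [Pi.add_apply, Pi.single_apply]
      split_ifs <;> subst_vars <;> first | omega | contradiction

theorem exists_two_supplies (hc : ∀ u v, G.Adj u v → c u ≠ c v)
    (hm : ∀ b, #{v | c v = b} = m) (hk : ∀ v, k ≤ #{w | G.Adj v w}) (hmk : m < 2 * k)
    (hR : ¬ Reaches G C r) (hC : ∑ v, C v = Fintype.card V) (hZ : #{v | C v = 0} + 2 < k) :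
    ∃ x y e₁ e₂ w₁ w₂, Supplies G r e₁ w₁ ∧ Supplies G r e₂ w₂ ∧ e₁ + e₂ ≤ C ∧
      (∀ a, c a = c r → a ≠ x → a ≠ y → e₁ a = 0 ∧ e₂ a = 0) ∧ c w₁ ≠ c r ∧ c w₂ ≠ c r ∧
      (∀ u t, G.Adj w₁ u → C u ≠ 0 → G.Adj u t → G.Adj t r → C t = 0) ∧
      (∀ u t, G.Adj w₂ u → C u ≠ 0 → G.Adj u t → G.Adj t r → C t = 0) := by
  have hr : C r = 0 := by
    by_contra h
    exact hR (reaches_of_pos (by omega))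
  by_cases h4 : ∃ x, 4 ≤ C x
  · obtain ⟨x, hx⟩ := h4
    have hcx : c x ≠ c r := fun h => by
      have := le_three_of_not_reaches hc hm hk hmk hR h
      omega
    obtain ⟨e, w, -, -, -, -, -, hw, -, hbad⟩ := exists_supplies hc hk hR (A := ∅) (x := x)
      (by simp; omega) (by omega) (by simp)
    obtain rfl := hw hcx
    refine ⟨w, w, _, _, w, w, supplies_self, supplies_self, fun a => ?_,
      fun a _ ha _ => by simp [ha], hcx, hcx, hbad, hbad⟩
    simp only [Pi.add_apply, Pi.single_apply]
    split_ifs <;> subst_vars <;> omega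
  push Not at h4
  obtain ⟨x, hx⟩ : ∃ x, 2 ≤ C x := by
    by_contra! h
    have : ∑ v, C v < ∑ _v : V, 1 :=
      sum_lt_sum (fun v _ => by have := h v; omega) ⟨r, mem_univ r, by omega⟩
    simp [hC] at this
  have hocc : ∀ v, ∃ u, G.Adj v u ∧ C u ≠ 0 := by
    intro v
    by_contra! h
    have : #{w | G.Adj v w} ≤ #{v | C v = 0} :=
      card_le_card fun u hu => by simpa using h u (by simpa using hu)
    have := hk v
    omega
  obtain ⟨y, hyx, hy⟩ : ∃ y, y ≠ x ∧ 2 ≤ C y := by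
    by_contra! h
    obtain ⟨e, w, -, -, -, -, hcw, -, hwr, hbad⟩ := exists_supplies hc hk hR (A := ∅) (x := x)
      (by simp; omega) hx (by simp)
    obtain ⟨t₁, hrt₁, ht₁⟩ := hocc r
    obtain ⟨a₀, ha₀w, ha₀t⟩ := exists_common_adj hc hm hk hmk (u := w) (v := t₁) (by
      have := hc _ _ hrt₁
      revert this hcw
      cases c w <;> cases c r <;> cases c t₁ <;> simp)
    have ha₀ : C a₀ = 0 := by
      by_contra h
      exact ht₁ (hbad a₀ t₁ ha₀w.symm h ha₀t hrt₁.symm)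
    obtain ⟨u₀, hwu₀, hu₀⟩ := hocc w
    have hcu₀ : c u₀ = c r := by
      have := hc _ _ hwu₀
      revert this hcw
      cases c w <;> cases c r <;> cases c u₀ <;> simp
    obtain ⟨t₀, ht₀u, ht₀r⟩ := exists_common_adj hc hm hk hmk hcu₀
    have ht₀ : C t₀ = 0 := hbad u₀ t₀ hwu₀ hu₀ ht₀u.symm ht₀r
    have h1 : a₀ ≠ r := by rintro rfl; exact hwr ha₀w.symm
    have h2 : t₀ ≠ r := ht₀r.ne
    have h3 : t₀ ≠ a₀ := by
      rintro rfl
      have h5 := hc _ _ ha₀w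
      have h6 := hc _ _ ht₀r
      revert h5 h6 hcw
      cases c w <;> cases c r <;> cases c t₀ <;> simp
    have key : ∑ v, (C v + if v ∈ ({t₀, a₀, r} : Finset V) then 1 else 0) ≤
        ∑ v, (1 + if v ∈ ({x} : Finset V) then 2 else 0) := by
      refine sum_le_sum fun v _ => ?_
      have h5 := h v
      have h6 := h4 v
      simp only [mem_insert, mem_singleton]
      split_ifs <;> grind
    simp only [sum_add_distrib, hC, ← sum_filter, sum_const, filter_mem_eq_inter, univ_inter,
      card_singleton, card_eq_three.2 ⟨t₀, a₀, r, h3, h2, h1, rfl⟩, card_univ, smul_eq_mul] at key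
    omega
  obtain ⟨e₁, w₁, hs₁, hw₁y, hle₁, he₁, hcw₁, -, -, hbad₁⟩ := exists_supplies hc hk hR
    (A := {y}) (x := x) (by simp; omega) hx (by simpa using hyx.symm)
  rw [mem_singleton] at hw₁y
  obtain ⟨e₂, w₂, hs₂, hw₂, hle₂, he₂, hcw₂, -, -, hbad₂⟩ := exists_supplies hc hk hR
    (A := {x, w₁}) (x := y) (by have := card_le_two (a := x) (b := w₁); omega) hy
    (by simp [hyx, Ne.symm hw₁y])
  simp only [mem_insert, mem_singleton, not_or] at hw₂
  refine ⟨x, y, e₁, e₂, w₁, w₂, hs₁, hs₂, fun a => ?_, fun a ha hax hay => ⟨?_, ?_⟩, hcw₁, hcw₂,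
    hbad₁, hbad₂⟩
  · have h1 := hle₁ a
    have h2 := hle₂ a
    rw [Pi.add_apply]
    by_cases ha : a = x ∨ a = w₁
    · rw [he₂ a (by grind) (by grind)]
      exact h1
    · push Not at ha
      rw [he₁ a ha.1 ha.2, zero_add]
      exact h2
  · exact he₁ a hax (by rintro rfl; exact hcw₁ ha)
  · exact he₂ a hay (by rintro rfl; exact hcw₂ ha)

theorem reaches_of_sum_eq_card (hc : ∀ u v, G.Adj u v → c u ≠ c v)
    (hm : ∀ b, #{v | c v = b} = m) (hk : ∀ v, k ≤ #{w | G.Adj v w}) (hmk : m < 2 * k)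
    (hm' : 336 ≤ m) (hC : ∑ v, C v = Fintype.card V) : Reaches G C r := by
  by_contra hR
  set Z : Finset V := {v | C v = 0} with hZdef
  have hZ : #Z ≤ 52 := card_zero_le hc hm hk hmk hR hC
  have hZmem : ∀ v, v ∈ Z ↔ C v = 0 := by simp [hZdef]
  obtain ⟨x, y, e₁, e₂, w₁, w₂, hs₁, hs₂, hle, he, hcw₁, hcw₂, hbad₁, hbad₂⟩ :=
    exists_two_supplies hc hm hk hmk hR hC
      ((Nat.add_le_add_right hZ 2).trans_lt (by omega))
  obtain ⟨t₁, hrt₁, ht₁⟩ : ∃ t, G.Adj r t ∧ t ∉ Z := by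
    by_contra! h
    have : #{w | G.Adj r w} ≤ #Z := card_le_card fun u hu => h u (by simpa using hu)
    have := hk r
    omega
  rw [hZmem] at ht₁
  have hside : ∀ w, c w ≠ c r → ∀ u, G.Adj w u → c u = c r := by
    intro w hw u hwu
    have := hc w u hwu
    revert this hw
    cases c w <;> cases c r <;> cases c u <;> simp
  set N₁ : Finset V := {u | G.Adj w₁ u} with hN₁
  set N₂ : Finset V := {u | G.Adj w₂ u} with hN₂
  set N : Finset V := {u | G.Adj t₁ u} with hN
  set J : Finset V := ((N₁ ∩ N₂) \ Z) \ {x, y} with hJdef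
  have hJ : ∀ u ∈ J, G.Adj w₁ u ∧ G.Adj w₂ u ∧ C u ≠ 0 ∧ u ≠ x ∧ u ≠ y := by
    intro u hu
    simp only [hJdef, hN₁, hN₂, hZdef, mem_sdiff, mem_inter, mem_filter, mem_univ, true_and,
      mem_insert, mem_singleton, not_or] at hu
    tauto
  have hcardJ : #Z < #J := by
    have h1 : #(((N₁ ∪ N₂) \ Z) ∪ N) ≤ m := by
      rw [← hm (c r)]
      refine card_le_card fun u hu => ?_
      simp only [hN, hN₁, hN₂, mem_union, mem_sdiff, mem_filter, mem_univ, true_and] at hu ⊢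
      rcases hu with ⟨hu | hu, -⟩ | hu
      · exact hside _ hcw₁ _ hu
      · exact hside _ hcw₂ _ hu
      · exact hside _ (hc _ _ hrt₁).symm _ hu
    rw [card_union_of_disjoint] at h1
    · have h2 := le_card_sdiff Z (N₁ ∪ N₂)
      have h3 := card_union_add_card_inter N₁ N₂
      have h4 := le_card_sdiff Z (N₁ ∩ N₂)
      have h5 : #((N₁ ∩ N₂) \ Z) - #{x, y} ≤ #J := le_card_sdiff _ _
      have h6 := card_le_two (a := x) (b := y)
      have h7 : k ≤ #N₁ := hk w₁
      have h8 : k ≤ #N₂ := hk w₂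
      have h9 : k ≤ #N := hk t₁
      omega
    · rw [Finset.disjoint_left]
      intro u hu huN
      simp only [hN, hN₁, hN₂, hZdef, mem_union, mem_sdiff, mem_filter, mem_univ,
        true_and] at hu huN
      rcases hu with ⟨hu | hu, hu0⟩
      · exact ht₁ (hbad₁ u t₁ hu hu0 huN.symm hrt₁.symm)
      · exact ht₁ (hbad₂ u t₁ hu hu0 huN.symm hrt₁.symm)
  have hex : ∀ u, ∃ t, u ∈ J → G.Adj t u ∧ G.Adj t r := by
    intro u
    by_cases hu : u ∈ J
    · obtain ⟨t, ht⟩ := exists_common_adj hc hm hk hmk (hside w₁ hcw₁ u (hJ u hu).1)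
      exact ⟨t, fun _ => ht⟩
    · exact ⟨u, fun h => absurd h hu⟩
  choose f hf using hex
  obtain ⟨u₁, hu₁, u₂, hu₂, hne, hfu⟩ := exists_ne_map_eq_of_card_lt_of_maps_to hcardJ
    (f := f) fun u hu => by
      have hu' := hJ u hu
      have := hf u hu
      exact (hZmem _).2 (hbad₁ u _ hu'.1 hu'.2.2.1 this.1.symm this.2)
  obtain ⟨h11, -, h13, h14, h15⟩ := hJ u₁ hu₁
  obtain ⟨h21, h22, h23, h24, h25⟩ := hJ u₂ hu₂
  have hf₁ := hf u₁ hu₁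
  have hf₂ := hf u₂ hu₂
  rw [← hfu] at hf₂
  refine hR (reaches_mono (reaches_of_supplies_two hs₁ hs₂ h11 h22 hf₁.1.symm hf₂.1.symm hf₁.2)
    fun a => ?_)
  have h1 := hle a
  have h2 := he u₁ (hside w₁ hcw₁ u₁ h11) h14 h15
  have h3 := he u₂ (hside w₁ hcw₁ u₂ h21) h24 h25
  simp only [Pi.add_apply, Pi.single_apply] at h1 ⊢
  split_ifs <;> subst_vars <;> first | omega | contradiction

end Unsolvable

section PebblingNumber

variable [Fintype V] {G : SimpleGraph V}

theorem card_le_of_forall_reaches [Nonempty V] {n : ℕ}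
    (h : ∀ (r : V) (C : V → ℕ), ∑ v, C v = n → Reaches G C r) : Fintype.card V ≤ n := by
  classical
  by_contra! hn
  obtain ⟨r⟩ := ‹Nonempty V›
  obtain ⟨S, hS, hSn⟩ := exists_subset_card_eq (s := univ.erase r) (n := n)
    (by rw [card_erase_of_mem (mem_univ r), card_univ]; omega)
  refine not_reaches_of_le_one (C := fun v => if v ∈ S then 1 else 0) (r := r) (G := G) ?_ ?_
    (h r _ ?_)
  · intro v
    split_ifs <;> simp
  · simpa using fun hr => notMem_erase r univ (hS hr)
  · simp [hSn]

theorem pebblingNumber_eq_card [Nonempty V]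
    (h : ∀ (r : V) (C : V → ℕ), ∑ v, C v = Fintype.card V → Reaches G C r) :
    pebblingNumber G = Fintype.card V :=
  le_antisymm (Nat.sInf_le h) (card_le_of_forall_reaches (Nat.sInf_mem
    (s := {n | ∀ (r : V) (C : V → ℕ), ∑ v, C v = n → Reaches G C r}) ⟨_, h⟩))

theorem reaches_of_pebblingNumber_eq_card [Nonempty V]
    (h : pebblingNumber G = Fintype.card V) {r : V} {C : V → ℕ}
    (hC : ∑ v, C v = Fintype.card V) : Reaches G C r := by
  have hpos : 0 < sInf {n : ℕ | ∀ (r : V) (C : V → ℕ), ∑ v, C v = n → Reaches G C r} := by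
    change 0 < pebblingNumber G
    rw [h]
    exact Fintype.card_pos
  have := Nat.sInf_mem (Nat.nonempty_of_pos_sInf hpos)
  exact this r C (hC.trans h.symm)

end PebblingNumber

section TwoBlocks

/-- Two complete bipartite graphs, on the vertices with index below `h` and on the remaining
ones, joined by the edge between the left vertex `0` and the right vertex `h`. -/
def twoBlocks (m h : ℕ) : SimpleGraph (Fin m ⊕ Fin m) where
  Adj
    | .inl i, .inr j => (i.val < h ↔ j.val < h) ∨ (i.val = 0 ∧ j.val = h)
    | .inr j, .inl i => (i.val < h ↔ j.val < h) ∨ (i.val = 0 ∧ j.val = h)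
    | _, _ => False
  symm := ⟨by rintro (i | i) (j | j) <;> simp⟩
  loopless := ⟨by rintro (i | i) <;> simp⟩

variable {m h : ℕ}

theorem twoBlocks_adj {i j : Fin m} : (twoBlocks m h).Adj (.inl i) (.inr j) ↔
    (i.val < h ↔ j.val < h) ∨ (i.val = 0 ∧ j.val = h) := Iff.rfl

theorem twoBlocks_connected (h0 : 0 < h) (hm : h < m) : (twoBlocks m h).Connected := by
  have hadj : ∀ i j : Fin m, ((i.val < h ↔ j.val < h) ∨ (i.val = 0 ∧ j.val = h)) →
      (twoBlocks m h).Reachable (.inl i) (.inr j) :=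
    fun i j hij => (twoBlocks_adj.2 hij).reachable
  have h1 : ∀ j : Fin m, j.val < h → (twoBlocks m h).Reachable (.inl ⟨0, by omega⟩) (.inr j) :=
    fun j hj => hadj _ _ (by simp; omega)
  have h2 : (twoBlocks m h).Reachable (.inl ⟨0, by omega⟩) (.inr ⟨h, hm⟩) :=
    hadj _ _ (by simp)
  have h3 : ∀ i : Fin m, (twoBlocks m h).Reachable (.inl ⟨0, by omega⟩) (.inl i) := by
    intro i
    by_cases hi : i.val < h
    · exact (h1 ⟨0, by omega⟩ h0).trans (hadj _ _ (by simp; omega)).symm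
    · exact h2.trans (hadj _ _ (by simp; omega)).symm
  have h4 : ∀ v, (twoBlocks m h).Reachable (.inl ⟨0, by omega⟩) v := by
    rintro (i | j)
    · exact h3 i
    · by_cases hj : j.val < h
      · exact h1 j hj
      · exact (h3 ⟨h, hm⟩).trans (hadj _ _ (by simp; omega))
  have : Nonempty (Fin m ⊕ Fin m) := ⟨.inl ⟨0, by omega⟩⟩
  exact ⟨fun u v => (h4 u).symm.trans (h4 v)⟩

theorem le_ncard_twoBlocks_neighborSet (hm : 2 * h ≤ m) (v : Fin m ⊕ Fin m) :
    h ≤ ((twoBlocks m h).neighborSet v).ncard := by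
  have key : ∀ (i : Fin m) (f : Fin m → Fin m ⊕ Fin m), f.Injective →
      (∀ j : Fin m, (i.val < h ↔ j.val < h) → (twoBlocks m h).Adj v (f j)) →
      h ≤ ((twoBlocks m h).neighborSet v).ncard := by
    intro i f hf hadj
    let g : Fin h → Fin m ⊕ Fin m := fun a =>
      f (if i.val < h then ⟨a, by omega⟩ else ⟨a + h, by omega⟩)
    have hg : g.Injective := by
      intro a b hab
      have := hf hab
      split_ifs at this <;> simpa [Fin.ext_iff] using this
    have hsub : Set.range g ⊆ (twoBlocks m h).neighborSet v := by
      rintro _ ⟨a, rfl⟩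
      refine hadj _ ?_
      split_ifs with hi <;> simp [hi]
    calc h = (Set.range g).ncard := by
          rw [← Set.image_univ, Set.ncard_image_of_injective _ hg, Set.ncard_univ,
            Nat.card_eq_fintype_card, Fintype.card_fin]
      _ ≤ _ := Set.ncard_le_ncard hsub (Set.toFinite _)
  rcases v with i | j
  · exact key i .inr Sum.inr_injective fun j hj => .inl hj
  · exact key j .inl Sum.inl_injective fun i hi => .inl hi.symm

theorem pebblingNumber_twoBlocks_ne (h0 : 0 < h) (hm : h < m) :
    pebblingNumber (twoBlocks m h) ≠ Fintype.card (Fin m ⊕ Fin m) := by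
  intro heq
  have : Nonempty (Fin m ⊕ Fin m) := ⟨.inl ⟨0, by omega⟩⟩
  let z : Fin m := ⟨0, by omega⟩
  let a : Fin m := ⟨h, hm⟩
  have hza : a ≠ z := by simp [a, z, Fin.ext_iff]; omega
  let C : Fin m ⊕ Fin m → ℕ :=
    Sum.elim (fun i => if i = z then 0 else 1)
      (fun j => if j = z then 0 else if j = a then 3 else 1)
  refine not_reaches_of_cut (G := twoBlocks m h) (S := {v | h ≤ (Sum.elim id id v).val})
    (x := .inl z) (r := .inr z) (C := C) (a := .inr a) ?_ ?_ ?_ ?_ ?_ ?_ ?_ ?_ ?_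
    (reaches_of_pebblingNumber_eq_card heq ?_)
  · simp [z, h0.ne']
  · simp [z, h0.ne']
  · simp
  · rintro (i | i) hi (j | j) hij
    · exact hij.elim
    · simp only [twoBlocks_adj, Set.mem_ofPred_eq, Sum.elim_inl, Sum.elim_inr, id] at *
      left
      omega
    · rw [SimpleGraph.adj_comm] at hij
      simp only [twoBlocks_adj, Set.mem_ofPred_eq, Sum.elim_inl, Sum.elim_inr, id, Sum.inl.injEq,
        Fin.ext_iff, z] at *
      omega
    · exact hij.elim
  · simp [a]
  · simp [C, hza]
  · rintro (i | j) hv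
    · simp only [C, Sum.elim_inl]
      split_ifs <;> simp
    · have : j ≠ a := fun h => hv (congrArg _ h)
      simp only [C, Sum.elim_inr, if_neg this]
      split_ifs <;> simp
  · simp [C]
  · simp [C]
  · have h1 : ∑ i : Fin m, ((if i = z then 0 else 1) + if i = z then 1 else 0) = m := by
      rw [sum_congr rfl (g := fun _ => 1) (fun i _ => by split_ifs <;> rfl)]
      simp
    have h2 : ∑ j : Fin m, ((if j = z then 0 else if j = a then 3 else 1) +
        if j = z then 1 else 0) = ∑ j : Fin m, (1 + if j = a then 2 else 0) := by
      refine sum_congr rfl fun j _ => ?_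
      split_ifs <;> simp_all
    simp only [sum_add_distrib, sum_ite_eq', mem_univ, if_true, sum_const, card_univ,
      Fintype.card_fin, smul_eq_mul, mul_one] at h1 h2
    simp only [C, Fintype.sum_sum_type, Sum.elim_inl, Sum.elim_inr, Fintype.card_sum,
      Fintype.card_fin]
    omega

end TwoBlocks

theorem pebblingNumber_eq_card_of_bipartite {m : ℕ} (hm : 336 ≤ m)
    (G : SimpleGraph (Fin m ⊕ Fin m)) (hl : ∀ u v, ¬ G.Adj (Sum.inl u) (Sum.inl v))
    (hr : ∀ u v, ¬ G.Adj (Sum.inr u) (Sum.inr v))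
    (hdeg : ∀ v, m / 2 + 1 ≤ (G.neighborSet v).ncard) :
    pebblingNumber G = Fintype.card (Fin m ⊕ Fin m) := by
  classical
  have : Nonempty (Fin m ⊕ Fin m) := ⟨.inl ⟨0, by omega⟩⟩
  refine pebblingNumber_eq_card fun r C hC =>
    reaches_of_sum_eq_card (c := Sum.isLeft) (m := m) (k := m / 2 + 1) ?_ ?_ ?_ (by omega) hm hC
  · rintro (u | u) (v | v) huv
    · exact (hl u v huv).elim
    · simp
    · simp
    · exact (hr u v huv).elim
  · intro b
    rw [card_filter, Fintype.sum_sum_type]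
    cases b <;> simp
  · intro v
    convert hdeg v using 1
    rw [Set.ncard_eq_toFinset_card']
    congr 1
    ext w
    simp

theorem lt_bipartiteClass0Bound {m : ℕ} (hm : 2 ≤ m) : m / 2 < bipartiteClass0Bound m := by
  unfold bipartiteClass0Bound
  refine lt_of_not_ge fun hle => pebblingNumber_twoBlocks_ne (m := m) (h := m / 2) (by omega)
    (by omega) ?_
  refine Nat.sInf_mem (s := {k : ℕ | ∀ G : SimpleGraph (Fin m ⊕ Fin m), G.Connected →
    (∀ u v, ¬ G.Adj (Sum.inl u) (Sum.inl v)) → (∀ u v, ¬ G.Adj (Sum.inr u) (Sum.inr v)) →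
    (∀ v, k ≤ (G.neighborSet v).ncard) → pebblingNumber G = Fintype.card (Fin m ⊕ Fin m)})
    ⟨2 * m + 1, fun G _ _ _ hdeg => ?_⟩ _ (twoBlocks_connected (by omega) (by omega))
    (fun _ _ => id) (fun _ _ => id)
    fun v => hle.trans (le_ncard_twoBlocks_neighborSet (by omega) v)
  have h1 := hdeg (.inl ⟨0, by omega⟩)
  have h2 := Set.ncard_le_card (G.neighborSet (.inl ⟨0, by omega⟩))
  simp only [Nat.card_eq_fintype_card, Fintype.card_sum, Fintype.card_fin] at h2
  omega

end Pebbling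

/-- Czygrinow–Hurlbert: `b(m) ≥ ⌊m/2⌋ + 1` for all `m ≥ 7`, and
`b(m) = ⌊m/2⌋ + 1` for all `m ≥ 336`. -/
theorem bipartiteClass0Bound_value :
    (∀ m : ℕ, 7 ≤ m → m / 2 + 1 ≤ bipartiteClass0Bound m) ∧
      (∀ m : ℕ, 336 ≤ m → bipartiteClass0Bound m = m / 2 + 1) := by
  refine ⟨fun m hm => Pebbling.lt_bipartiteClass0Bound (by omega), fun m hm =>
    le_antisymm (Nat.sInf_le ?_) (Pebbling.lt_bipartiteClass0Bound (by omega))⟩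
  exact fun G _ hl hr hdeg => Pebbling.pebblingNumber_eq_card_of_bipartite hm G hl hr hdeg
end

section
/- Let n ≥ 1 and let w be a positive weight function on the vertices of the complete graph K_n. Then the weighted cover pebbling number satisfies γ_w(K_n) = 2|w| − min w, where |w| = Σ_v w(v) and min w = min_v w(v). -/
open SimpleGraph Finset

variable {V : Type*}

/-- A configuration `C` is `w`-solvable if some finite sequence of pebbling steps
starting from `C` produces a configuration with at least `w v` pebbles on each `v`. -/
def WSolvable (G : SimpleGraph V) (w C : V → ℕ) : Prop :=
  ∃ C', Relation.ReflTransGen (PebStep G) C C' ∧ ∀ v, w v ≤ C' v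

/-- The weighted cover pebbling number `γ_w(G)`: the least `m` such that every
configuration of size `m` is `w`-solvable. -/
noncomputable def coverPebblingNumber (G : SimpleGraph V) [Fintype V] (w : V → ℕ) : ℕ :=
  sInf {m : ℕ | ∀ C : V → ℕ, ∑ v, C v = m → WSolvable G w C}

/-- Giving weight `1` to `r` and weight `2` to every other vertex yields a potential that
no pebbling step increases. -/
theorem PebStep.potential_le [Fintype V] [DecidableEq V] {G : SimpleGraph V} {C C' : V → ℕ}
    (h : PebStep G C C') (r : V) :
    ∑ x, (if x = r then 1 else 2) * C' x ≤ ∑ x, (if x = r then 1 else 2) * C x := by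
  obtain ⟨u, v, huv, hu, hC'⟩ := h
  have hne : v ≠ u := huv.ne'
  have h_v : C' v = C v + 1 := by simp [hC']
  have h_u : C' u = C u - 2 := by simp [hC', hne.symm]
  have hv : v ∈ univ.erase u := by simp [hne]
  rw [← add_sum_erase univ _ (mem_univ u), ← add_sum_erase univ _ (mem_univ u),
    ← add_sum_erase _ _ hv, ← add_sum_erase _ _ hv]
  have hrest : ∀ x ∈ (univ.erase u).erase v,
      (if x = r then 1 else 2) * C' x = (if x = r then 1 else 2) * C x := by
    intro x hx
    simp only [mem_erase] at hx
    simp [hC', hx.1, hx.2.1]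
  rw [sum_congr rfl hrest]
  rw [h_v, h_u]
  split_ifs <;> omega

theorem potential_le_of_reflTransGen [Fintype V] [DecidableEq V] {G : SimpleGraph V}
    {C C' : V → ℕ} (h : Relation.ReflTransGen (PebStep G) C C') (r : V) :
    ∑ x, (if x = r then 1 else 2) * C' x ≤ ∑ x, (if x = r then 1 else 2) * C x := by
  induction h with
  | refl => exact le_rfl
  | tail _ hstep ih => exact (hstep.potential_le r).trans ih

/-- A solvable configuration concentrated on a single vertex `r` has at least
`2|w| - w r` pebbles. -/
theorem le_of_wSolvable_single [Fintype V] [DecidableEq V] {G : SimpleGraph V} {w : V → ℕ}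
    {r : V} {m : ℕ} (h : WSolvable G w (Pi.single r m)) : 2 * ∑ v, w v ≤ m + w r := by
  obtain ⟨C', hC', hw⟩ := h
  have hpot := potential_le_of_reflTransGen hC' r
  have hmono : ∑ x, (if x = r then 1 else 2) * w x ≤ ∑ x, (if x = r then 1 else 2) * C' x :=
    sum_le_sum fun x _ => Nat.mul_le_mul_left _ (hw x)
  have hsingle : ∑ x, (if x = r then 1 else 2) * (Pi.single r m : V → ℕ) x = m := by
    rw [sum_eq_single r] <;> simp +contextual
  have hw_pot : ∑ x, (if x = r then 1 else 2) * w x + w r = 2 * ∑ v, w v := by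
    rw [← add_sum_erase univ _ (mem_univ r), ← add_sum_erase univ w (mem_univ r),
      sum_congr rfl (g := fun x => 2 * w x) fun x hx => by simp [ne_of_mem_erase hx], ← mul_sum]
    simp only [if_true]
    ring
  omega

/-- On a complete graph it suffices that the surplus pebbles, taken in pairs vertex by vertex,
are at least as many as the missing pebbles. -/
theorem wSolvable_top_of_deficit_le [Fintype V] (w C : V → ℕ)
    (h : ∑ x, (w x - C x) ≤ ∑ x, (C x - w x) / 2) :
    WSolvable (⊤ : SimpleGraph V) w C := by
  classical
  induction hd : ∑ x, (w x - C x) generalizing C with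
  | zero =>
    refine ⟨C, .refl, fun v => ?_⟩
    have := (sum_eq_zero_iff.mp hd) v (mem_univ v)
    omega
  | succ d ih =>
    obtain ⟨v, -, hv⟩ := exists_ne_zero_of_sum_ne_zero (s := univ) (f := fun x => w x - C x)
      (by omega)
    obtain ⟨u, -, hu⟩ := exists_ne_zero_of_sum_ne_zero (s := univ)
      (f := fun x => (C x - w x) / 2) (by omega)
    have hvu : v ≠ u := by rintro rfl; omega
    set C₁ := Function.update (Function.update C u (C u - 2)) v (C v + 1) with hC₁
    have h_v : C₁ v = C v + 1 := by simp [hC₁]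
    have h_u : C₁ u = C u - 2 := by simp [hC₁, hvu.symm]
    have h_rest : ∀ x, x ≠ u → x ≠ v → C₁ x = C x := fun x hxu hxv => by simp [hC₁, hxu, hxv]
    have hdeficit : ∑ x, (w x - C₁ x) + 1 = ∑ x, (w x - C x) := by
      rw [← add_sum_erase univ _ (mem_univ v), ← add_sum_erase univ _ (mem_univ v),
        sum_congr rfl (g := fun x => w x - C x) fun x hx => ?_]
      · omega
      · by_cases hxu : x = u
        · subst hxu; omega
        · rw [h_rest x hxu (ne_of_mem_erase hx)]
    have hsurplus : ∑ x, (C₁ x - w x) / 2 + 1 = ∑ x, (C x - w x) / 2 := by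
      rw [← add_sum_erase univ _ (mem_univ u), ← add_sum_erase univ _ (mem_univ u),
        sum_congr rfl (g := fun x => (C x - w x) / 2) fun x hx => ?_]
      · omega
      · by_cases hxv : x = v
        · subst hxv; omega
        · rw [h_rest x (ne_of_mem_erase hx) hxv]
    obtain ⟨C', hC', hw⟩ := ih C₁ (by omega) (by omega)
    exact ⟨C', hC'.head ⟨u, v, by simpa using hvu.symm, by omega, hC₁⟩, hw⟩

theorem wSolvable_top_of_le_sum [Fintype V] [Nonempty V] {w C : V → ℕ} (hw : ∀ v, 0 < w v)
    {μ : ℕ} (hμ : ∀ v, μ ≤ w v) (h : 2 * ∑ v, w v ≤ ∑ v, C v + μ) :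
    WSolvable (⊤ : SimpleGraph V) w C := by
  classical
  apply wSolvable_top_of_deficit_le
  obtain ⟨u, hu⟩ : ∃ u, w u ≤ C u := by
    by_contra! hlt
    have hsum : ∑ v, C v < ∑ v, w v := sum_lt_sum_of_nonempty univ_nonempty fun v _ => hlt v
    obtain ⟨v⟩ := ‹Nonempty V›
    have := single_le_sum (f := w) (fun _ _ => Nat.zero_le _) (mem_univ v)
    have := hμ v
    omega
  have hbalance : ∑ x, C x + ∑ x, (w x - C x) = ∑ x, w x + ∑ x, (C x - w x) := by
    simp only [← sum_add_distrib]
    exact sum_congr rfl fun x _ => by omega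
  have hparity : ∑ x, (w x - C x) + ∑ x, (C x - w x) + w u
      ≤ ∑ x, w x + 2 * ∑ x, (C x - w x) / 2 + 1 := by
    simp only [mul_sum, ← sum_add_distrib]
    rw [← add_sum_erase univ _ (mem_univ u),
      ← add_sum_erase univ (fun x => w x + 2 * ((C x - w x) / 2)) (mem_univ u)]
    have : ∑ x ∈ univ.erase u, (w x - C x + (C x - w x))
        ≤ ∑ x ∈ univ.erase u, (w x + 2 * ((C x - w x) / 2)) :=
      sum_le_sum fun x _ => by have := hw x; omega
    omega
  have := hμ u
  omega

/-- for every positive weight function `w` on the complete graph `K_n`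
(`n ≥ 1`), the weighted cover pebbling number is `2|w| − min w`. -/
theorem coverPebblingNumber_completeGraph (n : ℕ) (hn : 1 ≤ n) (w : Fin n → ℕ)
    (hw : ∀ v, 0 < w v) :
    coverPebblingNumber (⊤ : SimpleGraph (Fin n)) w =
      2 * (∑ v, w v) - Finset.univ.inf' ⟨⟨0, hn⟩, Finset.mem_univ _⟩ w := by
  have : NeZero n := ⟨by omega⟩
  obtain ⟨r, -, hr⟩ := exists_mem_eq_inf' (⟨⟨0, hn⟩, mem_univ _⟩ : univ.Nonempty) w
  have hmin : ∀ v, w r ≤ w v := fun v => hr ▸ inf'_le w (mem_univ v)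
  rw [hr]
  refine IsLeast.csInf_eq ⟨fun C hC => ?_, fun m hm => ?_⟩
  · exact wSolvable_top_of_le_sum hw hmin (by omega)
  · have := le_of_wSolvable_single (hm (Pi.single r m) (by simp))
    omega
end

section
/- (Stacking Theorem; Sjöstrand, Vuong–Wyckoff) Let G be a finite connected simple graph and let w be a positive weight function on the vertices of G. Then γ_w(G) = s_w(G), where s_w(G) = max_v Σ_u w(u)·2^{dist(u,v)} and dist(u,v) denotes the distance between vertices u and v in G. -/
open SimpleGraph Finset

variable {V : Type*}

open Classical in
/-- The effect of a pebbling step from `u` to `v`, written additively. -/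
lemma pebbleMove_add (C : V → ℕ) {u v : V} (huv : u ≠ v) (hu : 2 ≤ C u) (x : V) :
    Function.update (Function.update C u (C u - 2)) v (C v + 1) x + (if x = u then 2 else 0) =
      C x + (if x = v then 1 else 0) := by
  by_cases hxv : x = v
  · subst hxv
    simp [huv.symm]
  · by_cases hxu : x = u
    · subst hxu
      simp [hxv]
      omega
    · simp [hxv, hxu]

open Classical in
lemma weight_pebbleMove [Fintype V] (W C : V → ℕ) {u v : V} (huv : u ≠ v) (hu : 2 ≤ C u) :
    ∑ x, Function.update (Function.update C u (C u - 2)) v (C v + 1) x * W x + 2 * W u =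
      ∑ x, C x * W x + W v := by
  have h := Finset.sum_congr rfl fun x (_ : x ∈ (univ : Finset V)) =>
    congrArg (· * W x) (pebbleMove_add C huv hu x)
  simpa [add_mul, Finset.sum_add_distrib, ite_mul] using h

/-- Weighting each pebble by `2 ^ dist` to a fixed vertex, pebbling never increases the total. -/
lemma weight_dist_le_of_reflTransGen [Fintype V] {G : SimpleGraph V} (hG : G.Connected) (v : V)
    {C C' : V → ℕ} (h : Relation.ReflTransGen (PebStep G) C C') :
    ∑ x, C' x * 2 ^ G.dist x v ≤ ∑ x, C x * 2 ^ G.dist x v := by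
  induction h with
  | refl => exact le_rfl
  | tail _ hstep ih =>
    obtain ⟨a, b, hab, ha, rfl⟩ := hstep
    have hsum := weight_pebbleMove (fun x => 2 ^ G.dist x v) _ hab.ne ha
    have hdist : G.dist b v ≤ G.dist a v + 1 := by
      have := hG.dist_triangle (u := b) (v := a) (w := v)
      rw [SimpleGraph.dist_eq_one_iff_adj.2 hab.symm] at this
      omega
    have hpow : 2 ^ G.dist b v ≤ 2 * 2 ^ G.dist a v := by
      rw [← pow_succ']
      exact Nat.pow_le_pow_right two_pos hdist
    omega

/-- Along a walk on which the height `D` increases by one at each step and whose inner vertices are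
occupied, one pebble can be pushed to the end without changing the total of `2 ^ D`. -/
lemma exists_push_along_walk [Fintype V] {G : SimpleGraph V} {D : V → ℕ}
    (hD : ∀ u v, D u ≤ D v + G.dist u v) {a b : V} (p : G.Walk a b) :
    0 < p.length → D b = D a + p.length →
    ∀ C : V → ℕ, 2 ≤ C a → (∀ u, D a < D u → D u < D b → 1 ≤ C u) →
    ∃ C', Relation.ReflTransGen (PebStep G) C C' ∧ C' b = C b + 1 ∧ C' a + 2 ≤ C a ∧
      (∀ u, u ≠ b → C' u ≤ C u) ∧ ∑ u, C' u * 2 ^ D u = ∑ u, C u * 2 ^ D u := by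
  classical
  induction p with
  | nil => simp
  | @cons a c b hac p ih =>
    intro _ hlen C hCa hC
    rw [Walk.length_cons] at hlen
    have hDc : D c = D a + 1 := by
      have h₁ := hD c a
      have h₂ := hD b c
      rw [SimpleGraph.dist_eq_one_iff_adj.2 hac.symm] at h₁
      have h₃ := SimpleGraph.dist_le p
      rw [SimpleGraph.dist_comm] at h₃
      omega
    have hadd := pebbleMove_add C hac.ne hCa
    have hsum := weight_pebbleMove (fun x => 2 ^ D x) C hac.ne hCa
    have hstep : PebStep G C (Function.update (Function.update C a (C a - 2)) c (C c + 1)) :=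
      ⟨a, c, hac, hCa, by congr!⟩
    generalize Function.update (Function.update C a (C a - 2)) c (C c + 1) = C₁ at *
    have hsum₁ : ∑ u, C₁ u * 2 ^ D u = ∑ u, C u * 2 ^ D u := by
      simp only [hDc, pow_succ'] at hsum
      omega
    have ha₁ := hadd a
    have hc₁ := hadd c
    simp only [hac.ne, hac.ne', if_true, if_false] at ha₁ hc₁
    have hother : ∀ u, u ≠ c → C₁ u ≤ C u := fun u hu => by
      have := hadd u
      simp only [hu, if_false] at this
      omega
    by_cases hp : p.length = 0
    · obtain rfl := Walk.eq_of_length_eq_zero hp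
      exact ⟨C₁, .single hstep, by omega, by omega, hother, hsum₁⟩
    · have hab : a ≠ b := by rintro rfl; omega
      have hbc : b ≠ c := by rintro rfl; omega
      have hb₁ := hadd b
      simp only [hab.symm, hbc, if_false] at hb₁
      have hc_pos := hC c (by omega) (by omega)
      obtain ⟨C', hreach, hb, hc, hle, hsum'⟩ := ih (by omega) (by omega) C₁ (by omega) (by
        intro u hu₁ hu₂
        have hua : u ≠ a := by rintro rfl; omega
        have huc : u ≠ c := by rintro rfl; omega
        have := hadd u
        simp only [hua, huc, if_false] at this
        have := hC u (by omega) hu₂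
        omega)
      refine ⟨C', .head hstep hreach, by omega, ?_, fun u hu => ?_, hsum'.trans hsum₁⟩
      · have := hle a hab
        omega
      · by_cases huc : u = c
        · subst huc
          omega
        · exact (hle u hu).trans (hother u huc)

/-- The distance to a nonempty finite set of vertices. -/
lemma exists_dist_to_finset {G : SimpleGraph V} (hG : G.Connected) {F : Finset V}
    (hF : F.Nonempty) :
    ∃ D : V → ℕ, (∀ u, ∀ f ∈ F, D u ≤ G.dist u f) ∧ (∀ u, ∃ f ∈ F, D u = G.dist u f) ∧
      ∀ u v, D u ≤ D v + G.dist u v := by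
  choose φ hφ hmin using fun u => F.exists_min_image (fun f => G.dist u f) hF
  refine ⟨fun u => G.dist u (φ u), hmin, fun u => ⟨φ u, hφ u, rfl⟩, fun u v => ?_⟩
  have h₁ := hmin u (φ v) (hφ v)
  have h₂ := hG.dist_triangle (u := u) (v := v) (w := φ v)
  exact h₁.trans (h₂.trans_eq (add_comm _ _))

/-- A configuration is solvable as soon as its total weight, each pebble at `u` being worth
`2 ^ D u` for a height `D` bounded by the distance to every overfull vertex and to some vertex,
is at least the stacking number. -/
lemma wSolvable_of_le_weight [Fintype V] {G : SimpleGraph V} (hG : G.Connected) {w : V → ℕ}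
    (hw : ∀ v, 0 < w v) (n : ℕ) :
    ∀ C D : V → ℕ, ∑ u, (C u - w u) = n → (∃ g, ∀ u, D u ≤ G.dist u g) →
    (∀ f, w f < C f → ∀ u, D u ≤ G.dist u f) →
    (∀ g, ∑ u, w u * 2 ^ G.dist u g ≤ ∑ u, C u * 2 ^ D u) → WSolvable G w C := by
  classical
  induction n using Nat.strong_induction_on with
  | _ n ih =>
    intro C D hn hg hfat hweight
    by_cases hthin : ∀ v, w v ≤ C v
    · exact ⟨C, .refl, hthin⟩
    push Not at hthin
    obtain ⟨t₀, ht₀⟩ := hthin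
    let F : Finset V := univ.filter fun f => w f < C f
    have hF : F.Nonempty := by
      by_contra hF
      have hle : ∀ u, C u ≤ w u := fun u => by
        by_contra hu
        exact hF ⟨u, by simp [F]; omega⟩
      obtain ⟨g, hg⟩ := hg
      refine (hweight g).not_gt (Finset.sum_lt_sum (fun u _ => ?_) ⟨t₀, mem_univ _, ?_⟩)
      · exact Nat.mul_le_mul (hle u) (Nat.pow_le_pow_right two_pos (hg u))
      · calc C t₀ * 2 ^ D t₀ ≤ C t₀ * 2 ^ G.dist t₀ g :=
              Nat.mul_le_mul_left _ (Nat.pow_le_pow_right two_pos (hg t₀))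
          _ < w t₀ * 2 ^ G.dist t₀ g := Nat.mul_lt_mul_of_pos_right ht₀ (by positivity)
    obtain ⟨E, hE_le, hE_eq, hE_lip⟩ := exists_dist_to_finset hG hF
    have hDE : ∀ u, D u ≤ E u := fun u => by
      obtain ⟨f, hf, hfE⟩ := hE_eq u
      rw [hfE]
      exact hfat f (by simpa [F] using hf) u
    obtain ⟨t, ht, htmin⟩ := (univ.filter fun t => C t < w t).exists_min_image E
      ⟨t₀, by simpa using ht₀⟩
    obtain ⟨f, hfF, hft⟩ := hE_eq t
    have ht : C t < w t := by simpa using ht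
    have hf : w f < C f := by simpa [F] using hfF
    have hEf : E f = 0 := by simpa using hE_le f f hfF
    have hne : f ≠ t := by rintro rfl; omega
    obtain ⟨p, hp⟩ := hG.exists_walk_length_eq_dist f t
    rw [SimpleGraph.dist_comm] at hft
    obtain ⟨C', hreach, ht', hf', hle, hsum⟩ := exists_push_along_walk hE_lip p
      (by rw [hp]; exact hG.pos_dist_of_ne hne) (by omega) C (by have := hw f; omega) (by
        intro u _ hut
        by_contra hu
        have := htmin u (by have := hw u; simp; omega)
        omega)
    have hfat' : ∀ v, w v < C' v → v ∈ F := fun v hv => by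
      have hvt : v ≠ t := by rintro rfl; omega
      have := hle v hvt
      simp [F]
      omega
    obtain ⟨C'', hreach', hcov⟩ := ih (∑ u, (C' u - w u)) (by
        rw [← hn]
        refine Finset.sum_lt_sum (fun u _ => ?_) ⟨f, mem_univ _, by omega⟩
        by_cases hut : u = t
        · subst hut
          omega
        · have := hle u hut
          omega) C' E rfl ⟨f, fun u => hE_le u f hfF⟩ (fun v hv u => hE_le u v (hfat' v hv))
      (fun g => by
        rw [hsum]
        exact (hweight g).trans (Finset.sum_le_sum fun u _ =>
          Nat.mul_le_mul_left _ (Nat.pow_le_pow_right two_pos (hDE u))))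
    exact ⟨C'', hreach.trans hreach', hcov⟩

/-- Stacking Theorem; Sjöstrand, Vuong–Wyckoff: for every finite
connected simple graph `G` and positive weight function `w`,
`γ_w(G) = s_w(G) = max_v ∑_u w(u)·2^{dist(u,v)}`. -/
theorem coverPebblingNumber_eq_stacking [Fintype V] (G : SimpleGraph V) (hG : G.Connected)
    (w : V → ℕ) (hw : ∀ v, 0 < w v) :
    coverPebblingNumber G w =
      Finset.univ.sup (fun v : V => ∑ u, w u * 2 ^ G.dist u v) := by
  classical
  have hmem : Finset.univ.sup (fun v : V => ∑ u, w u * 2 ^ G.dist u v) ∈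
      {m : ℕ | ∀ C : V → ℕ, ∑ v, C v = m → WSolvable G w C} := by
    intro C hC
    refine wSolvable_of_le_weight hG hw _ C (fun _ => 0) rfl ?_ (fun _ _ _ => Nat.zero_le _)
      fun g => ?_
    · obtain ⟨g⟩ := hG.nonempty
      exact ⟨g, fun _ => Nat.zero_le _⟩
    · simp only [pow_zero, mul_one, hC]
      exact Finset.le_sup (f := fun v : V => ∑ u, w u * 2 ^ G.dist u v) (mem_univ g)
  refine le_antisymm (Nat.sInf_le hmem) (le_csInf ⟨_, hmem⟩ fun m hm => Finset.sup_le fun v _ => ?_)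
  obtain ⟨C', hreach, hcov⟩ := hm (Pi.single v m) (by simp)
  calc ∑ u, w u * 2 ^ G.dist u v ≤ ∑ u, C' u * 2 ^ G.dist u v :=
        Finset.sum_le_sum fun u _ => Nat.mul_le_mul_right _ (hcov u)
    _ ≤ ∑ u, (Pi.single v m : V → ℕ) u * 2 ^ G.dist u v :=
        weight_dist_le_of_reflTransGen hG v hreach
    _ = m := by simp [Pi.single_apply, ite_mul]
end

section
/- (Fu–Shiue) For all finite connected simple graphs G and H, the optimal pebbling number satisfies π*(G □ H) ≤ π*(G)·π*(H). -/
open SimpleGraph Finset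

variable {V : Type*}

/-- The optimal pebbling number `π*(G)`: the least size of a configuration that
reaches every vertex of `G`. -/
noncomputable def optPebblingNumber (G : SimpleGraph V) [Fintype V] : ℕ :=
  sInf {m : ℕ | ∃ C : V → ℕ, ∑ v, C v = m ∧ ∀ r : V, Reaches G C r}

open Classical in
theorem pebStep_iff_exists_add {G : SimpleGraph V} {C C' : V → ℕ} :
    PebStep G C C' ↔ ∃ u v : V, ∃ F : V → ℕ, G.Adj u v ∧
      C = F + 2 • Pi.single u 1 ∧ C' = F + Pi.single v 1 := by
  constructor
  · rintro ⟨u, v, huv, hu, rfl⟩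
    refine ⟨u, v, Function.update C u (C u - 2), huv, ?_, ?_⟩
    · ext x
      by_cases hx : x = u
      · subst hx
        simp
        omega
      · simp [hx]
    · ext x
      by_cases hx : x = v
      · subst hx
        simp [huv.ne']
      · simp [hx]
  · rintro ⟨u, v, F, huv, rfl, rfl⟩
    refine ⟨u, v, huv, by simp, ?_⟩
    ext x
    by_cases hx : x = v
    · subst hx
      simp [huv.ne']
    · by_cases hxu : x = u
      · subst hxu
        simp [hx]
      · simp [hx, hxu]

/-- Pebbles that are left aside do not obstruct a sequence of pebbling steps. -/
theorem reflTransGen_pebStep_add_left {G : SimpleGraph V} {C C' : V → ℕ} (F : V → ℕ)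
    (h : Relation.ReflTransGen (PebStep G) C C') :
    Relation.ReflTransGen (PebStep G) (F + C) (F + C') := by
  refine h.lift (F + ·) fun A B hAB => ?_
  obtain ⟨u, v, E, huv, rfl, rfl⟩ := pebStep_iff_exists_add.1 hAB
  exact pebStep_iff_exists_add.2 ⟨u, v, F + E, huv, (add_assoc _ _ _).symm,
    (add_assoc _ _ _).symm⟩

theorem reflTransGen_pebStep_add {G : SimpleGraph V} {C C' D D' : V → ℕ}
    (hC : Relation.ReflTransGen (PebStep G) C C') (hD : Relation.ReflTransGen (PebStep G) D D') :
    Relation.ReflTransGen (PebStep G) (C + D) (C' + D') := by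
  refine (reflTransGen_pebStep_add_left C hD).trans ?_
  rw [add_comm C, add_comm C']
  exact reflTransGen_pebStep_add_left D' hC

theorem reflTransGen_pebStep_nsmul {G : SimpleGraph V} {C C' : V → ℕ} (n : ℕ)
    (h : Relation.ReflTransGen (PebStep G) C C') :
    Relation.ReflTransGen (PebStep G) (n • C) (n • C') := by
  induction n with
  | zero => simpa using Relation.ReflTransGen.refl
  | succ n ih => simpa only [succ_nsmul] using reflTransGen_pebStep_add ih h

theorem reflTransGen_pebStep_sum {ι : Type*} {G : SimpleGraph V} (s : Finset ι)
    {C C' : ι → V → ℕ} (h : ∀ i ∈ s, Relation.ReflTransGen (PebStep G) (C i) (C' i)) :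
    Relation.ReflTransGen (PebStep G) (∑ i ∈ s, C i) (∑ i ∈ s, C' i) := by
  classical
  induction s using Finset.induction_on with
  | empty => simpa using Relation.ReflTransGen.refl
  | insert a s ha ih =>
    rw [sum_insert ha, sum_insert ha]
    exact reflTransGen_pebStep_add (h a (mem_insert_self a s))
      (ih fun i hi => h i (mem_insert_of_mem hi))

open Classical in
/-- An additive map of configurations preserves reachability as soon as it turns every single
step along an edge into a sequence of pebbling steps. -/
theorem reflTransGen_pebStep_map {X : Type*} {G : SimpleGraph V} {K : SimpleGraph X}
    (φ : (V → ℕ) →+ (X → ℕ))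
    (hφ : ∀ u v, G.Adj u v →
      Relation.ReflTransGen (PebStep K) (2 • φ (Pi.single u 1)) (φ (Pi.single v 1)))
    {C C' : V → ℕ} (h : Relation.ReflTransGen (PebStep G) C C') :
    Relation.ReflTransGen (PebStep K) (φ C) (φ C') := by
  induction h with
  | refl => exact .refl
  | tail _ hs ih =>
    refine ih.trans ?_
    obtain ⟨u, v, F, huv, rfl, rfl⟩ := pebStep_iff_exists_add.1 hs
    rw [map_add, map_add, map_nsmul]
    exact reflTransGen_pebStep_add_left _ (hφ u v huv)

theorem reflTransGen_pebStep_single [DecidableEq V] {G : SimpleGraph V} {u v : V}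
    (h : G.Adj u v) :
    Relation.ReflTransGen (PebStep G) (2 • Pi.single u 1) (Pi.single v 1) := by
  refine .single (pebStep_iff_exists_add.2 ⟨u, v, 0, h, ?_, ?_⟩) <;> rw [zero_add] <;> congr!

/-- The product of two configurations, as a configuration on the product of the vertex sets. -/
def prodConfig {W : Type*} : (V → ℕ) →+ (W → ℕ) →+ (V × W → ℕ) where
  toFun C :=
    { toFun := fun D p => C p.1 * D p.2
      map_zero' := by ext; simp
      map_add' := fun _ _ => by ext; simp [mul_add] }
  map_zero' := by ext; simp
  map_add' _ _ := by ext; simp [add_mul]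

@[simp]
theorem prodConfig_apply {W : Type*} (C : V → ℕ) (D : W → ℕ) (p : V × W) :
    prodConfig C D p = C p.1 * D p.2 := rfl

open Classical in
theorem prodConfig_single_left {W : Type*} [Fintype W] (u : V) (D : W → ℕ) :
    prodConfig (Pi.single u 1) D = ∑ w, D w • Pi.single (u, w) 1 := by
  ext ⟨x, y⟩
  by_cases hx : x = u <;> simp [Finset.sum_apply, Pi.single_apply, hx]

open Classical in
theorem prodConfig_single_right {W : Type*} [Fintype V] (C : V → ℕ) (w : W) :
    prodConfig C (Pi.single w 1) = ∑ v, C v • Pi.single (v, w) 1 := by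
  ext ⟨x, y⟩
  by_cases hy : y = w <;> simp [Finset.sum_apply, Pi.single_apply, hy]

theorem reflTransGen_pebStep_prodConfig {W : Type*} [Fintype V] [Fintype W]
    {G : SimpleGraph V} {H : SimpleGraph W} {C C' : V → ℕ} {D D' : W → ℕ}
    (hC : Relation.ReflTransGen (PebStep G) C C') (hD : Relation.ReflTransGen (PebStep H) D D') :
    Relation.ReflTransGen (PebStep (G □ H)) (prodConfig C D) (prodConfig C' D') := by
  classical
  refine (reflTransGen_pebStep_map (prodConfig.flip D) (fun u v huv => ?_) hC).trans
    (reflTransGen_pebStep_map (prodConfig C') (fun u v huv => ?_) hD)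
  · rw [AddMonoidHom.flip_apply, AddMonoidHom.flip_apply, prodConfig_single_left,
      prodConfig_single_left, smul_sum]
    refine reflTransGen_pebStep_sum _ fun w _ => ?_
    rw [smul_comm]
    exact reflTransGen_pebStep_nsmul _
      (reflTransGen_pebStep_single (boxProd_adj.2 (.inl ⟨huv, rfl⟩)))
  · rw [prodConfig_single_right, prodConfig_single_right, smul_sum]
    refine reflTransGen_pebStep_sum _ fun w _ => ?_
    rw [smul_comm]
    exact reflTransGen_pebStep_nsmul _
      (reflTransGen_pebStep_single (boxProd_adj.2 (.inr ⟨huv, rfl⟩)))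

theorem Reaches.prodConfig {W : Type*} [Fintype V] [Fintype W]
    {G : SimpleGraph V} {H : SimpleGraph W} {C : V → ℕ} {D : W → ℕ} {r : V} {s : W}
    (hC : Reaches G C r) (hD : Reaches H D s) :
    Reaches (G □ H) (_root_.prodConfig C D) (r, s) := by
  obtain ⟨C', hCC', hr⟩ := hC
  obtain ⟨D', hDD', hs⟩ := hD
  exact ⟨_, reflTransGen_pebStep_prodConfig hCC' hDD', Nat.mul_pos hr hs⟩

theorem exists_sum_eq_optPebblingNumber [Fintype V] (G : SimpleGraph V) :
    ∃ C : V → ℕ, ∑ v, C v = optPebblingNumber G ∧ ∀ r : V, Reaches G C r :=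
  Nat.sInf_mem (s := {m : ℕ | ∃ C : V → ℕ, ∑ v, C v = m ∧ ∀ r : V, Reaches G C r})
    ⟨_, 1, rfl, fun _ => ⟨1, .refl, le_rfl⟩⟩

/-- Fu–Shiue: for all finite connected simple graphs `G` and `H`,
`π*(G □ H) ≤ π*(G)·π*(H)`. -/
theorem optPebblingNumber_boxProd {W : Type*} [Fintype V] [Fintype W]
    (G : SimpleGraph V) (H : SimpleGraph W) (hG : G.Connected) (hH : H.Connected) :
    optPebblingNumber (G □ H) ≤ optPebblingNumber G * optPebblingNumber H := by
  obtain ⟨C, hC, hCr⟩ := exists_sum_eq_optPebblingNumber G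
  obtain ⟨D, hD, hDr⟩ := exists_sum_eq_optPebblingNumber H
  refine Nat.sInf_le ⟨prodConfig C D, ?_, fun r => (hCr r.1).prodConfig (hDr r.2)⟩
  rw [← hC, ← hD, Fintype.sum_mul_sum, Fintype.sum_prod_type]
  rfl
end

section
/- (Czygrinow) Let G be a finite connected simple graph with n vertices and minimum degree k. Then the optimal pebbling number satisfies π*(G) ≤ 4n/(k+1), i.e. (k+1)·π*(G) ≤ 4n. -/
open SimpleGraph Finset

variable {V : Type*}

theorem Reaches.of_pos {G : SimpleGraph V} {C : V → ℕ} {r : V} (h : 1 ≤ C r) : Reaches G C r :=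
  ⟨C, Relation.ReflTransGen.refl, h⟩

theorem Reaches.of_step {G : SimpleGraph V} {C C' : V → ℕ} {r : V} (hs : PebStep G C C')
    (h : Reaches G C' r) : Reaches G C r :=
  let ⟨D, hD, hr⟩ := h
  ⟨D, Relation.ReflTransGen.head hs hD, hr⟩

theorem Reaches.of_adj {G : SimpleGraph V} {C : V → ℕ} {u r : V} (hur : G.Adj u r)
    (h : 2 ≤ C u) : Reaches G C r :=
  .of_step ⟨u, r, hur, h, rfl⟩ (.of_pos (by simp))

theorem Reaches.of_adj_adj {G : SimpleGraph V} {C : V → ℕ} {u w r : V} (huw : G.Adj u w)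
    (hwr : G.Adj w r) (h : 4 ≤ C u) : Reaches G C r := by
  classical
  refine .of_step ⟨u, w, huw, by omega, rfl⟩ (.of_step ⟨u, w, huw, ?_, rfl⟩ (.of_adj hwr ?_))
  · simp only [Function.update_of_ne huw.ne, Function.update_self]
    omega
  · simp

open Classical in
/-- A maximal family of vertices with pairwise disjoint closed neighborhoods: every vertex has
a closed neighborhood meeting that of some member. -/
theorem exists_disjoint_closedNeighborhoods [Fintype V] (G : SimpleGraph V) :
    ∃ S : Finset V,
      (S : Set V).PairwiseDisjoint (fun v => insert v (G.neighborFinset v)) ∧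
      ∀ r : V, ∃ s ∈ S, ∃ w, w ∈ insert s (G.neighborFinset s) ∧
        w ∈ insert r (G.neighborFinset r) := by
  obtain ⟨S, hS⟩ := Set.Finite.exists_maximal
    (s := {S : Finset V |
      (S : Set V).PairwiseDisjoint (fun v => insert v (G.neighborFinset v))})
    (Set.toFinite _) ⟨∅, by simp⟩
  refine ⟨S, hS.prop, fun r => ?_⟩
  by_contra! h
  have hins : ((insert r S : Finset V) : Set V).PairwiseDisjoint
      (fun v => insert v (G.neighborFinset v)) := by
    rw [Finset.coe_insert]
    refine Set.PairwiseDisjoint.insert hS.prop fun s hs _ => ?_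
    exact Finset.disjoint_left.2 fun w hr hws => h s hs w hws hr
  have hr : r ∈ S := hS.le_of_ge hins (Finset.subset_insert r S) (Finset.mem_insert_self r S)
  exact h r hr r (Finset.mem_insert_self _ _) (Finset.mem_insert_self _ _)

/-- Czygrinow: if `G` is a finite connected simple graph on `n`
vertices with minimum degree `k`, then `(k+1)·π*(G) ≤ 4n`. -/
theorem optPebblingNumber_minDegree [Fintype V] (G : SimpleGraph V) (hG : G.Connected)
    (k : ℕ) (hk : sInf {d : ℕ | ∃ v : V, (G.neighborSet v).ncard = d} = k) :
    (k + 1) * optPebblingNumber G ≤ 4 * Fintype.card V := by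
  classical
  obtain ⟨S, hdisj, hcov⟩ := exists_disjoint_closedNeighborhoods G
  have hdeg (v : V) : k + 1 ≤ (insert v (G.neighborFinset v)).card := by
    have hv : k ≤ (G.neighborSet v).ncard := hk ▸ Nat.sInf_le ⟨v, rfl⟩
    rw [Finset.card_insert_of_notMem (by simp)]
    rwa [← G.coe_neighborFinset, Set.ncard_coe_finset, ← Nat.succ_le_succ_iff] at hv
  have hcard : S.card * (k + 1) ≤ Fintype.card V := calc
    S.card * (k + 1) ≤ ∑ v ∈ S, (insert v (G.neighborFinset v)).card := by
      simpa using Finset.card_nsmul_le_sum S _ _ fun v _ => hdeg v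
    _ = (S.biUnion fun v => insert v (G.neighborFinset v)).card :=
      (Finset.card_biUnion hdisj).symm
    _ ≤ Fintype.card V := Finset.card_le_univ _
  have hopt : optPebblingNumber G ≤ 4 * S.card := by
    refine Nat.sInf_le ⟨fun v => if v ∈ S then 4 else 0, by simp [mul_comm], fun r => ?_⟩
    obtain ⟨s, hs, w, hsw, hrw⟩ := hcov r
    simp only [Finset.mem_insert, mem_neighborFinset] at hsw hrw
    rcases hsw with rfl | hsw <;> rcases hrw with rfl | hrw
    · exact .of_pos (by simp [hs])
    · exact .of_adj hrw.symm (by simp [hs])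
    · exact .of_adj hsw (by simp [hs])
    · exact .of_adj_adj hsw hrw.symm (by simp [hs])
  calc (k + 1) * optPebblingNumber G ≤ (k + 1) * (4 * S.card) := Nat.mul_le_mul_left _ hopt
    _ = 4 * (S.card * (k + 1)) := by ring
    _ ≤ 4 * Fintype.card V := Nat.mul_le_mul_left _ hcard
end
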